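/- Let N ≥ 3, let m ∈ (0, m_s], and let u be a radial energy solution of the fast diffusion equation with exponent m and extinction time T > 0. Then for every fixed t ∈ (0,T) and every integer k ≥ 1 there exist constants C₁ > 0 and C₂ > 0 (depending on t and k) such that |∂ᵏ_r u(r,t)| ≤ C₁ e^{−(N−1)r/m} and |∂ᵏ_t u(r,t)| ≤ C₂ e^{k(N−1)(1/m − 1) r} e^{−(N−1)r/m} for all r ≥ 0. -/

import Mathlib

open MeasureTheory Set Filter Topology

/-- Membership in the radial energy space `H¹_rad` on hyperbolic space `ℍ^N`:
`v` is locally absolutely continuous on `(0,∞)` (expressed via the fundamental theorem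
of calculus for its a.e. derivative) and both `v` and `v'` are square-integrable with
respect to the weight `(sinh s)^(N-1)`. -/
def MemH1rad (N : ℕ) (v : ℝ → ℝ) : Prop :=
  (∀ a b : ℝ, 0 < a → a ≤ b → v b - v a = ∫ s in a..b, deriv v s) ∧
  MeasureTheory.IntegrableOn (fun s => (v s) ^ 2 * Real.sinh s ^ (N - 1)) (Set.Ioi 0) ∧
  MeasureTheory.IntegrableOn (fun s => (deriv v s) ^ 2 * Real.sinh s ^ (N - 1)) (Set.Ioi 0)

/-- The squared `H¹` norm `‖v‖_2² + ‖v'‖_2²` with weight `(sinh s)^(N-1)`. -/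
noncomputable def H1normSq (N : ℕ) (v : ℝ → ℝ) : ℝ :=
  (∫ s in Set.Ioi (0:ℝ), (v s) ^ 2 * Real.sinh s ^ (N - 1)) +
  (∫ s in Set.Ioi (0:ℝ), (deriv v s) ^ 2 * Real.sinh s ^ (N - 1))

/-- A radial energy solution of the fast diffusion equation `u_t = Δ(u^m)` on `ℍ^N`,
with exponent `m`, extinction time `T` (initial datum `u(·,0)`). -/
structure IsRadialEnergySolution (N : ℕ) (m T : ℝ) (u : ℝ → ℝ → ℝ) : Prop where
  continuousOn : ContinuousOn (fun p : ℝ × ℝ => u p.1 p.2) (Set.Ici 0 ×ˢ Set.Icc 0 T)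
  nonneg : ∀ r ∈ Set.Ici (0:ℝ), ∀ t ∈ Set.Icc (0:ℝ) T, 0 ≤ u r t
  smooth : ContDiffOn ℝ (⊤ : ℕ∞) (fun p : ℝ × ℝ => u p.1 p.2) (Set.Ici 0 ×ˢ Set.Ioo 0 T)
  pos : ∀ r ∈ Set.Ici (0:ℝ), ∀ t ∈ Set.Ioo (0:ℝ) T, 0 < u r t
  pde : ∀ r > (0:ℝ), ∀ t ∈ Set.Ioo (0:ℝ) T,
    deriv (fun τ => u r τ) t
      = deriv (deriv (fun ρ => u ρ t ^ m)) r
        + ((N : ℝ) - 1) * (Real.cosh r / Real.sinh r) * deriv (fun ρ => u ρ t ^ m) r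
  neumann : ∀ t ∈ Set.Ioo (0:ℝ) T, deriv (fun ρ => u ρ t ^ m) 0 = 0
  extinction : ∀ r ∈ Set.Ici (0:ℝ), u r T = 0
  energy : ∀ t ∈ Set.Ioo (0:ℝ) T, MemH1rad N (fun ρ => u ρ t ^ m)
  energy_bdd : ∀ ε ∈ Set.Ioo (0:ℝ) T, ∃ C : ℝ, ∀ t ∈ Set.Ico ε T,
    H1normSq N (fun ρ => u ρ t ^ m) ≤ C
  init_bdd : ∃ M : ℝ, ∀ r ∈ Set.Ici (0:ℝ), u r 0 ≤ M
  init_nonzero : ∃ r ∈ Set.Ici (0:ℝ), u r 0 ≠ 0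
  init_energy : MemH1rad N (fun ρ => u ρ 0 ^ m)


namespace SDB

/-- open parabolic domain -/
def Om (T : ℝ) : Set (ℝ × ℝ) := Ioi 0 ×ˢ Ioo 0 T

lemma isOpen_Om (T : ℝ) : IsOpen (Om T) := isOpen_Ioi.prod isOpen_Ioo

lemma mem_Om {T r t : ℝ} : (r, t) ∈ Om T ↔ 0 < r ∧ 0 < t ∧ t < T := by
  simp [Om, Set.mem_prod]

/-- smooth on the domain -/
def Sm (T : ℝ) (f : ℝ × ℝ → ℝ) : Prop := ContDiffOn ℝ (⊤ : ℕ∞) f (Om T)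

noncomputable def Dr (f : ℝ × ℝ → ℝ) : ℝ × ℝ → ℝ := fun p => fderiv ℝ f p (1, 0)
noncomputable def Dt (f : ℝ × ℝ → ℝ) : ℝ × ℝ → ℝ := fun p => fderiv ℝ f p (0, 1)

variable {T : ℝ}

lemma Sm.contDiffAt {f : ℝ × ℝ → ℝ} (hf : Sm T f) {p : ℝ × ℝ} (hp : p ∈ Om T) :
    ContDiffAt ℝ (⊤ : ℕ∞) f p := ContDiffOn.contDiffAt hf ((isOpen_Om T).mem_nhds hp)

lemma Sm.diffAt {f : ℝ × ℝ → ℝ} (hf : Sm T f) {p : ℝ × ℝ} (hp : p ∈ Om T) :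
    DifferentiableAt ℝ f p := (hf.contDiffAt hp).differentiableAt (by simp)

lemma Sm.fder {f : ℝ × ℝ → ℝ} (hf : Sm T f) (v : ℝ × ℝ) : Sm T (fun p => fderiv ℝ f p v) := by
  have h1 : ContDiffOn ℝ (⊤ : ℕ∞) (fderiv ℝ f) (Om T) :=
    ContDiffOn.fderiv_of_isOpen hf (isOpen_Om T) (by simp)
  exact h1.clm_apply contDiffOn_const

lemma Sm.Dr {f : ℝ × ℝ → ℝ} (hf : Sm T f) : Sm T (Dr f) := hf.fder _
lemma Sm.Dt {f : ℝ × ℝ → ℝ} (hf : Sm T f) : Sm T (Dt f) := hf.fder _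

lemma Sm.hasR {f : ℝ × ℝ → ℝ} (hf : Sm T f) {r t : ℝ} (hp : (r, t) ∈ Om T) :
    HasDerivAt (fun ρ => f (ρ, t)) (SDB.Dr f (r, t)) r := by
  have h1 := (hf.diffAt hp).hasFDerivAt
  have h2 : HasDerivAt (fun ρ : ℝ => (ρ, t)) ((1 : ℝ), (0 : ℝ)) r :=
    (hasDerivAt_id r).prodMk (hasDerivAt_const r t)
  exact h1.comp_hasDerivAt r h2

lemma Sm.hasT {f : ℝ × ℝ → ℝ} (hf : Sm T f) {r t : ℝ} (hp : (r, t) ∈ Om T) :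
    HasDerivAt (fun τ => f (r, τ)) (SDB.Dt f (r, t)) t := by
  have h1 := (hf.diffAt hp).hasFDerivAt
  have h2 : HasDerivAt (fun τ : ℝ => (r, τ)) ((0 : ℝ), (1 : ℝ)) t :=
    (hasDerivAt_const t r).prodMk (hasDerivAt_id t)
  exact h1.comp_hasDerivAt t h2

lemma Sm.Dr_eq {f : ℝ × ℝ → ℝ} (hf : Sm T f) {r t x : ℝ} (hp : (r, t) ∈ Om T)
    (h : HasDerivAt (fun ρ => f (ρ, t)) x r) : SDB.Dr f (r, t) = x :=
  (hf.hasR hp).unique h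

lemma Sm.Dt_eq {f : ℝ × ℝ → ℝ} (hf : Sm T f) {r t x : ℝ} (hp : (r, t) ∈ Om T)
    (h : HasDerivAt (fun τ => f (r, τ)) x t) : SDB.Dt f (r, t) = x :=
  (hf.hasT hp).unique h

lemma fder_congr {f g : ℝ × ℝ → ℝ} (h : ∀ p ∈ Om T, f p = g p) {p : ℝ × ℝ} (hp : p ∈ Om T) :
    fderiv ℝ f p = fderiv ℝ g p := by
  apply Filter.EventuallyEq.fderiv_eq
  filter_upwards [(isOpen_Om T).mem_nhds hp] with q hq using h q hq

lemma Dr_congr {f g : ℝ × ℝ → ℝ} (h : ∀ p ∈ Om T, f p = g p) :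
    ∀ p ∈ Om T, Dr f p = Dr g p := fun p hp => by simp [Dr, fder_congr h hp]

lemma Dt_congr {f g : ℝ × ℝ → ℝ} (h : ∀ p ∈ Om T, f p = g p) :
    ∀ p ∈ Om T, Dt f p = Dt g p := fun p hp => by simp [Dt, fder_congr h hp]

lemma Sm.comm {f : ℝ × ℝ → ℝ} (hf : Sm T f) {p : ℝ × ℝ} (hp : p ∈ Om T) :
    SDB.Dt (SDB.Dr f) p = SDB.Dr (SDB.Dt f) p := by
  have h1 : ContDiffOn ℝ (⊤ : ℕ∞) (fderiv ℝ f) (Om T) :=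
    ContDiffOn.fderiv_of_isOpen hf (isOpen_Om T) (by simp)
  have h2 : DifferentiableAt ℝ (fderiv ℝ f) p :=
    (h1.contDiffAt ((isOpen_Om T).mem_nhds hp)).differentiableAt (by simp)
  have h3 : IsSymmSndFDerivAt ℝ f p := (hf.contDiffAt hp).isSymmSndFDerivAt (by
      simp only [minSmoothness_of_isRCLikeNormedField]
      exact WithTop.coe_le_coe.2 (le_top : (2 : ℕ∞) ≤ ⊤))
  have e : ∀ v w : ℝ × ℝ, fderiv ℝ (fun q => fderiv ℝ f q v) p w
      = fderiv ℝ (fderiv ℝ f) p w v := by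
    intro v w
    rw [fderiv_clm_apply h2 (differentiableAt_const v)]
    simp
  simp only [SDB.Dt, SDB.Dr]
  erw [e, e]
  exact h3 _ _

lemma Sm.add {f g : ℝ × ℝ → ℝ} (hf : Sm T f) (hg : Sm T g) : Sm T (fun p => f p + g p) :=
  ContDiffOn.add hf hg
lemma Sm.sub {f g : ℝ × ℝ → ℝ} (hf : Sm T f) (hg : Sm T g) : Sm T (fun p => f p - g p) :=
  ContDiffOn.sub hf hg
lemma Sm.mul {f g : ℝ × ℝ → ℝ} (hf : Sm T f) (hg : Sm T g) : Sm T (fun p => f p * g p) :=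
  ContDiffOn.mul hf hg
lemma Sm.exp {f : ℝ × ℝ → ℝ} (hf : Sm T f) : Sm T (fun p => Real.exp (f p)) :=
  ContDiffOn.exp hf
lemma Sm.const (a : ℝ) : Sm T (fun _ => a) := contDiffOn_const
lemma Sm.fst : Sm T (fun p => p.1) := contDiffOn_fst
lemma Sm.snd : Sm T (fun p => p.2) := contDiffOn_snd
lemma Sm.pow {f : ℝ × ℝ → ℝ} (hf : Sm T f) (k : ℕ) : Sm T (fun p => f p ^ k) :=
  ContDiffOn.pow hf k

lemma Sm.Dr_add {f g : ℝ × ℝ → ℝ} (hf : Sm T f) (hg : Sm T g) {p : ℝ × ℝ} (hp : p ∈ Om T) :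
    SDB.Dr (fun p => f p + g p) p = SDB.Dr f p + SDB.Dr g p :=
  (hf.add hg).Dr_eq hp ((hf.hasR hp).add (hg.hasR hp))
lemma Sm.Dt_add {f g : ℝ × ℝ → ℝ} (hf : Sm T f) (hg : Sm T g) {p : ℝ × ℝ} (hp : p ∈ Om T) :
    SDB.Dt (fun p => f p + g p) p = SDB.Dt f p + SDB.Dt g p :=
  (hf.add hg).Dt_eq hp ((hf.hasT hp).add (hg.hasT hp))
lemma Sm.Dr_mul {f g : ℝ × ℝ → ℝ} (hf : Sm T f) (hg : Sm T g) {p : ℝ × ℝ} (hp : p ∈ Om T) :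
    SDB.Dr (fun p => f p * g p) p = SDB.Dr f p * g p + f p * SDB.Dr g p :=
  (hf.mul hg).Dr_eq hp ((hf.hasR hp).mul (hg.hasR hp))
lemma Sm.Dt_mul {f g : ℝ × ℝ → ℝ} (hf : Sm T f) (hg : Sm T g) {p : ℝ × ℝ} (hp : p ∈ Om T) :
    SDB.Dt (fun p => f p * g p) p = SDB.Dt f p * g p + f p * SDB.Dt g p :=
  (hf.mul hg).Dt_eq hp ((hf.hasT hp).mul (hg.hasT hp))
lemma Sm.Dr_exp {f : ℝ × ℝ → ℝ} (hf : Sm T f) {p : ℝ × ℝ} (hp : p ∈ Om T) :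
    SDB.Dr (fun p => Real.exp (f p)) p = Real.exp (f p) * SDB.Dr f p :=
  hf.exp.Dr_eq hp (hf.hasR hp).exp
lemma Sm.Dt_exp {f : ℝ × ℝ → ℝ} (hf : Sm T f) {p : ℝ × ℝ} (hp : p ∈ Om T) :
    SDB.Dt (fun p => Real.exp (f p)) p = Real.exp (f p) * SDB.Dt f p :=
  hf.exp.Dt_eq hp (hf.hasT hp).exp
lemma Dr_const (a : ℝ) (p : ℝ × ℝ) : Dr (fun _ => a) p = 0 := by simp [Dr]
lemma Dt_const (a : ℝ) (p : ℝ × ℝ) : Dt (fun _ => a) p = 0 := by simp [Dt]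

/-- coth -/
noncomputable def ct (p : ℝ × ℝ) : ℝ := Real.cosh p.1 / Real.sinh p.1

lemma Sm_ct : Sm T ct := by
  apply ContDiffOn.div
  · exact (Real.contDiff_cosh.comp contDiff_fst).contDiffOn
  · exact (Real.contDiff_sinh.comp contDiff_fst).contDiffOn
  · intro p hp
    exact (Real.sinh_pos_iff.2 hp.1).ne'

lemma Dr_ct {p : ℝ × ℝ} (hp : p ∈ Om T) : Dr ct p = 1 - ct p * ct p := by
  have h0 : 0 < Real.sinh p.1 := Real.sinh_pos_iff.2 hp.1
  apply Sm_ct.Dr_eq hp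
  have := (Real.hasDerivAt_cosh p.1).div (Real.hasDerivAt_sinh p.1) h0.ne'
  have e : 1 - ct p * ct p = (Real.sinh p.1 * Real.sinh p.1 - Real.cosh p.1 * Real.cosh p.1)
      / Real.sinh p.1 ^ 2 := by
    simp only [ct]
    field_simp
  rw [e]
  exact this

lemma Dt_ct {p : ℝ × ℝ} (hp : p ∈ Om T) : Dt ct p = 0 :=
  Sm_ct.Dt_eq hp (hasDerivAt_const _ (Real.cosh p.1 / Real.sinh p.1))

lemma ct_ge {r t : ℝ} (hr : 0 < r) : 1 + 2 * Real.exp (-2 * r) ≤ ct (r, t) := by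
  have h0 : 0 < Real.sinh r := Real.sinh_pos_iff.2 hr
  rw [ct, le_div_iff₀ h0]
  simp only [Real.cosh_eq, Real.sinh_eq]
  have e1 : Real.exp (-2 * r) = Real.exp (-r) * Real.exp (-r) := by rw [← Real.exp_add]; ring_nf
  have e2 : Real.exp r * Real.exp (-r) = 1 := by rw [← Real.exp_add]; simp
  rw [e1]
  have := Real.exp_pos (-r)
  nlinarith [mul_pos this (mul_pos this this)]

lemma ct_le {r t : ℝ} (hr : 1 ≤ r) : ct (r, t) ≤ 1 + 3 * Real.exp (-2 * r) := by
  have h0 : 0 < Real.sinh r := Real.sinh_pos_iff.2 (by linarith)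
  rw [ct, div_le_iff₀ h0]
  simp only [Real.cosh_eq, Real.sinh_eq]
  have e1 : Real.exp (-2 * r) = Real.exp (-r) * Real.exp (-r) := by rw [← Real.exp_add]; ring_nf
  have e2 : Real.exp r * Real.exp (-r) = 1 := by rw [← Real.exp_add]; simp
  have h2 : (2 : ℝ) ≤ Real.exp r := by linarith [Real.add_one_le_exp r]
  have := Real.exp_pos (-r)
  have h3 : Real.exp (-r) ≤ 1 / 2 := by nlinarith
  rw [e1]
  have h4 : Real.exp (-r) * Real.exp (-r) ≤ 1/4 := by nlinarith
  nlinarith [mul_le_mul_of_nonneg_left h4 this.le]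

lemma ct_one_le {r t : ℝ} (hr : 0 < r) : 1 ≤ ct (r, t) := by
  have := ct_ge (t := t) hr; have := Real.exp_pos (-2 * r); linarith

lemma ct_le_four {r t : ℝ} (hr : 1 ≤ r) : ct (r, t) ≤ 4 := by
  have := ct_le (t := t) hr
  have : Real.exp (-2 * r) ≤ 1 := Real.exp_le_one_iff.2 (by linarith)
  linarith

end SDB

namespace SDB
variable {T : ℝ}

lemma second_le {f : ℝ → ℝ} {r : ℝ} (h : IsLocalMax f r) (hc : ContinuousAt f r) :
    deriv (deriv f) r ≤ 0 := by
  by_contra hlt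
  push Not at hlt
  have h0 : deriv f r = 0 := h.deriv_eq_zero
  have hmin := isLocalMin_of_deriv_deriv_pos hlt h0 hc
  have heq : f =ᶠ[𝓝 r] fun _ => f r := by
    filter_upwards [h, hmin] with x h1 h2 using le_antisymm h1 h2
  have := heq.deriv.deriv_eq
  rw [this] at hlt
  simp at hlt

lemma Sm.locmax {f : ℝ × ℝ → ℝ} (hf : Sm T f) {r t : ℝ} (hp : (r, t) ∈ Om T)
    (h : IsLocalMax (fun ρ => f (ρ, t)) r) :
    SDB.Dr f (r, t) = 0 ∧ SDB.Dr (SDB.Dr f) (r, t) ≤ 0 := by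
  constructor
  · exact h.hasDerivAt_eq_zero (hf.hasR hp)
  · have e : deriv (fun ρ => f (ρ, t)) =ᶠ[𝓝 r] fun ρ => SDB.Dr f (ρ, t) := by
      filter_upwards [Ioi_mem_nhds (mem_Om.1 hp).1] with ρ hρ
      exact (hf.hasR (mem_Om.2 ⟨hρ, (mem_Om.1 hp).2⟩)).deriv
    have h2 := second_le h (hf.hasR hp).continuousAt
    rw [e.deriv_eq, (hf.Dr.hasR hp).deriv] at h2
    exact h2

lemma Sm.time_nonneg {f : ℝ × ℝ → ℝ} (hf : Sm T f) {r t : ℝ} (hp : (r, t) ∈ Om T)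
    (h : ∀ᶠ s in 𝓝[<] t, f (r, s) ≤ f (r, t)) : 0 ≤ SDB.Dt f (r, t) := by
  have h1 := (hf.hasT hp).hasDerivWithinAt (s := Iio t)
  rw [hasDerivWithinAt_iff_tendsto_slope' (by simp)] at h1
  apply ge_of_tendsto h1
  filter_upwards [h, self_mem_nhdsWithin] with s hs hst
  rw [slope_def_field]
  have : s < t := hst
  exact div_nonneg_of_nonpos (by linarith) (by linarith)

lemma Sm.cont {f : ℝ × ℝ → ℝ} (hf : Sm T f) : ContinuousOn f (Om T) := ContDiffOn.continuousOn hf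

lemma box_sub {a b t1 t2 : ℝ} (ha : 0 < a) (h1 : 0 < t1) (h2 : t2 < T) :
    Icc a b ×ˢ Icc t1 t2 ⊆ Om T := by
  rintro ⟨r, t⟩ ⟨hr, ht⟩
  exact mem_Om.2 ⟨lt_of_lt_of_le ha hr.1, lt_of_lt_of_le h1 ht.1, lt_of_le_of_lt ht.2 h2⟩

lemma touch {D : ℝ × ℝ → ℝ} (hD : Sm T D) {a b t1 t2 : ℝ} (ha : 0 < a) (h1 : 0 < t1)
    (h2 : t2 < T)
    (hinit : ∀ r ∈ Icc a b, D (r, t1) < 0)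
    (hleft : ∀ t ∈ Icc t1 t2, D (a, t) < 0)
    (hright : ∀ t ∈ Icc t1 t2, D (b, t) < 0)
    (hno : ∀ r t, a < r → r < b → t1 < t → t ≤ t2 → D (r, t) = 0 → Dr D (r, t) = 0 →
      Dr (Dr D) (r, t) ≤ 0 → 0 ≤ Dt D (r, t) → False) :
    ∀ r ∈ Icc a b, ∀ t ∈ Icc t1 t2, D (r, t) < 0 := by
  intro r0 hr0 t0 ht0
  by_contra hneg
  push Not at hneg
  set K := Icc a b ×ˢ Icc t1 t2 with hK
  have hsub : K ⊆ Om T := box_sub ha h1 h2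
  have hcK : ContinuousOn D K := hD.cont.mono hsub
  have hKc : IsCompact K := isCompact_Icc.prod isCompact_Icc
  have hZ : IsCompact (K ∩ D ⁻¹' Ici 0) :=
    hKc.of_isClosed_subset (hcK.preimage_isClosed_of_isClosed hKc.isClosed isClosed_Ici)
      inter_subset_left
  obtain ⟨⟨r, t⟩, ⟨hrt, hge⟩, hmin⟩ := hZ.exists_isMinOn ⟨(r0, t0), ⟨⟨hr0, ht0⟩, hneg⟩⟩
    continuous_snd.continuousOn
  have hge : 0 ≤ D (r, t) := hge
  have hr : r ∈ Icc a b := hrt.1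
  have ht : t ∈ Icc t1 t2 := hrt.2
  have hbefore : ∀ ρ ∈ Icc a b, ∀ s ∈ Icc t1 t2, s < t → D (ρ, s) < 0 := by
    intro ρ hρ s hs hst
    by_contra hc
    push Not at hc
    have := hmin (show (ρ, s) ∈ K ∩ D ⁻¹' Ici 0 from ⟨⟨hρ, hs⟩, hc⟩)
    simp at this
    linarith
  have hta : t1 < t := by
    rcases lt_or_eq_of_le ht.1 with h | h
    · exact h
    · have := hinit r hr
      rw [h] at this
      linarith
  have hra : a < r := by
    rcases lt_or_eq_of_le hr.1 with h | h
    · exact h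
    · have := hleft t ht
      rw [h] at this
      linarith
  have hrb : r < b := by
    rcases lt_or_eq_of_le hr.2 with h | h
    · exact h
    · have := hright t ht
      rw [← h] at this
      linarith
  have hev : ∀ᶠ s in 𝓝[<] t, t1 < s ∧ s < t := by
    filter_upwards [Ioo_mem_nhdsLT hta] with s hs using hs
  have hle : ∀ ρ ∈ Icc a b, D (ρ, t) ≤ 0 := by
    intro ρ hρ
    have hmem : (ρ, t) ∈ Om T := hsub ⟨hρ, ht⟩
    have hc : Tendsto (fun s => D (ρ, s)) (𝓝[<] t) (𝓝 (D (ρ, t))) :=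
      (hD.hasT hmem).continuousAt.tendsto.mono_left nhdsWithin_le_nhds
    apply le_of_tendsto hc
    filter_upwards [hev] with s hs
    exact (hbefore ρ hρ s ⟨hs.1.le, hs.2.le.trans ht.2⟩ hs.2).le
  have hzero : D (r, t) = 0 := le_antisymm (hle r hr) hge
  have hmem : (r, t) ∈ Om T := hsub hrt
  have hl := hD.locmax hmem (by
    filter_upwards [Icc_mem_nhds hra hrb] with ρ hρ
    simp only [hzero]
    exact hle ρ hρ)
  refine hno r t hra hrb hta ht.2 hzero hl.1 hl.2 (hD.time_nonneg hmem ?_)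
  filter_upwards [hev] with s hs
  rw [hzero]
  exact (hbefore r hr s ⟨hs.1.le, hs.2.le.trans ht.2⟩ hs.2).le

lemma zq1 (r0 r : ℝ) : HasDerivAt (fun x : ℝ => (1 - (x - r0) ^ 2) ^ 2)
    (2 * (1 - (r - r0) ^ 2) * (-(2 * (r - r0)))) r := by
  have := ((((hasDerivAt_id r).sub_const r0).pow 2).const_sub 1).pow 2
  exact this.congr_deriv (by simp)

lemma zq2 (r0 r : ℝ) : HasDerivAt (fun x : ℝ => 2 * (1 - (x - r0) ^ 2) * (-(2 * (x - r0))))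
    (8 * (r - r0) ^ 2 - 4 * (1 - (r - r0) ^ 2)) r := by
  have a1 := ((((hasDerivAt_id r).sub_const r0).pow 2).const_sub 1).const_mul 2
  have a2 := (((hasDerivAt_id r).sub_const r0).const_mul 2).neg
  exact (a1.mul a2).congr_deriv (by simp; ring)

lemma cutoff_alg {z e x W Wr Wrr Wt d : ℝ} (hz0 : 0 < z) (hz1 : z ≤ 1) (he0 : 0 < e)
    (hWpos : 0 < W) (hzd : z = 1 - x ^ 2)
    (hl1 : 2 * z * -(2 * x) * e * W + z ^ 2 * e * Wr = 0)
    (hl2 : (8 * x ^ 2 - 4 * z) * e * W + 2 * (2 * z * -(2 * x) * e * Wr) + z ^ 2 * e * Wrr ≤ 0)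
    (htn : 0 ≤ z ^ 2 * (1 / d) * W + z ^ 2 * e * Wt) :
    z ^ 2 * Wrr ≤ 28 * W ∧ z * |Wr| ≤ 4 * W ∧ 0 ≤ W / d + e * Wt := by
  have hx1 : x ^ 2 ≤ 1 := by linarith
  have hxa : |x| ≤ 1 := by rw [abs_le]; constructor <;> nlinarith
  have k1 : z * Wr = 4 * x * W := by
    have : z * e * (z * Wr - 4 * x * W) = 0 := by linarith
    rcases mul_eq_zero.1 this with h | h
    · exact absurd h (by positivity)
    · linarith
  have k2 : z ^ 2 * Wrr ≤ 28 * W := by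
    have : e * ((8 * x ^ 2 - 4 * z) * W + 2 * (2 * (-(2 * x)) * (z * Wr)) +
      z ^ 2 * Wrr) ≤ 0 := by linarith
    have h3 := nonpos_of_mul_nonpos_right this he0
    rw [k1] at h3
    nlinarith [mul_nonneg hWpos.le (sub_nonneg.2 hx1), mul_nonneg hWpos.le (sub_nonneg.2 hz1)]
  have k3 : 0 ≤ W / d + e * Wt := by
    have : 0 ≤ z ^ 2 * (W / d + e * Wt) := by
      have e1 : z ^ 2 * (W / d + e * Wt) =
        z ^ 2 * (1 / d) * W + z ^ 2 * e * Wt := by ring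
      rw [e1]; exact htn
    exact nonneg_of_mul_nonneg_right this (by positivity)
  have k4 : z * |Wr| ≤ 4 * W := by
    have : z * |Wr| = 4 * |x| * W := by
      rw [← abs_of_pos hz0, ← abs_mul, k1, abs_mul, abs_mul, abs_of_pos hWpos]; simp
    rw [this]
    nlinarith [mul_nonneg hWpos.le (sub_nonneg.2 hxa)]
  exact ⟨k2, k4, k3⟩

set_option maxHeartbeats 1000000 in
lemma cutoff {W : ℝ × ℝ → ℝ} (hW : Sm T W) {r0 t1 t2 C : ℝ} (hr0 : 2 ≤ r0) (h1 : 0 < t1)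
    (h12 : t1 < t2) (h2 : t2 < T) (hC : 0 ≤ C)
    (hyp : ∀ r t z e, r0 - 1 ≤ r → t1 ≤ t → t ≤ t2 → 0 < z → z ≤ 1 → 0 < e → e ≤ 1 →
      0 < W (r, t) →
      z ^ 2 * Dr (Dr W) (r, t) ≤ 28 * W (r, t) → z * |Dr W (r, t)| ≤ 4 * W (r, t) →
      0 ≤ W (r, t) / (t2 - t1) + e * Dt W (r, t) → z ^ 2 * e * W (r, t) ≤ C) :
    W (r0, t2) ≤ C := by
  rcases le_or_gt (W (r0, t2)) 0 with hneg | hpos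
  · linarith
  set F : ℝ × ℝ → ℝ := fun p => (1 - (p.1 - r0) ^ 2) ^ 2 * ((p.2 - t1) / (t2 - t1)) * W p with hF
  have h21 : 0 < t2 - t1 := by linarith
  have hz : Sm T (fun p : ℝ × ℝ => (1 - (p.1 - r0) ^ 2) ^ 2) :=
    (((Sm.const 1).sub ((Sm.fst.sub (Sm.const r0)).pow 2)).pow 2)
  have he : Sm T (fun p : ℝ × ℝ => (p.2 - t1) / (t2 - t1)) := by
    simp only [div_eq_mul_inv]
    exact (Sm.snd.sub (Sm.const t1)).mul (Sm.const _)
  have hFs : Sm T F := (hz.mul he).mul hW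
  set K := Icc (r0 - 1) (r0 + 1) ×ˢ Icc t1 t2 with hK
  have hsub : K ⊆ Om T := box_sub (by linarith) h1 h2
  have hKc : IsCompact K := isCompact_Icc.prod isCompact_Icc
  have hcen : (r0, t2) ∈ K := ⟨⟨by simp, by simp⟩, ⟨h12.le, le_rfl⟩⟩
  obtain ⟨⟨r, t⟩, hrt, hmax⟩ := hKc.exists_isMaxOn ⟨_, hcen⟩ (hFs.cont.mono hsub)
  have hFc : F (r0, t2) = W (r0, t2) := by
    simp [hF, div_self h21.ne']
  have hFge : W (r0, t2) ≤ F (r, t) := by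
    rw [← hFc]; exact hmax hcen
  have hFpos : 0 < F (r, t) := lt_of_lt_of_le hpos hFge
  have hr : r ∈ Icc (r0 - 1) (r0 + 1) := hrt.1
  have ht : t ∈ Icc t1 t2 := hrt.2
  have hFe : F (r, t) = (1 - (r - r0) ^ 2) ^ 2 * ((t - t1) / (t2 - t1)) * W (r, t) := rfl
  have hta : t1 < t := by
    rcases lt_or_eq_of_le ht.1 with h | h
    · exact h
    · rw [hFe, ← h] at hFpos
      simp at hFpos
  have hra : r0 - 1 < r := by
    rcases lt_or_eq_of_le hr.1 with h | h
    · exact h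
    · rw [hFe, ← h] at hFpos
      simp at hFpos
  have hrb : r < r0 + 1 := by
    rcases lt_or_eq_of_le hr.2 with h | h
    · exact h
    · rw [hFe, h] at hFpos
      simp at hFpos
  have hmem : (r, t) ∈ Om T := hsub hrt
  have hl := hFs.locmax hmem (by
    filter_upwards [Icc_mem_nhds hra hrb] with ρ hρ
    exact hmax (show (ρ, t) ∈ K from ⟨hρ, ht⟩))
  have htn := hFs.time_nonneg hmem (by
    filter_upwards [Ioo_mem_nhdsLT hta] with s hs
    exact hmax (show (r, s) ∈ K from ⟨hr, ⟨hs.1.le, hs.2.le.trans ht.2⟩⟩))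
  set z := 1 - (r - r0) ^ 2 with hzd
  set e := (t - t1) / (t2 - t1) with hed
  have hz0 : 0 < z := by rw [hzd]; nlinarith
  have hz1 : z ≤ 1 := by rw [hzd]; nlinarith
  have he0 : 0 < e := div_pos (by linarith) h21
  have he1 : e ≤ 1 := by rw [hed, div_le_one h21]; linarith [ht.2]
  have hWpos : 0 < W (r, t) := by
    rw [hFe] at hFpos
    exact pos_of_mul_pos_right hFpos (by positivity)
  -- derivatives
  have hdr : ∀ ρ, (ρ, t) ∈ Om T → Dr F (ρ, t) =
      (2 * (1 - (ρ - r0) ^ 2) * (-(2 * (ρ - r0)))) * e * W (ρ, t) +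
        (1 - (ρ - r0) ^ 2) ^ 2 * e * Dr W (ρ, t) := by
    intro ρ hρ
    apply hFs.Dr_eq hρ
    exact (((zq1 r0 ρ).mul_const e).mul (hW.hasR hρ))
  have hdrr : Dr (Dr F) (r, t) =
      (8 * (r - r0) ^ 2 - 4 * (1 - (r - r0) ^ 2)) * e * W (r, t) +
        2 * ((2 * (1 - (r - r0) ^ 2) * (-(2 * (r - r0)))) * e * Dr W (r, t)) +
        (1 - (r - r0) ^ 2) ^ 2 * e * Dr (Dr W) (r, t) := by
    apply hFs.Dr.Dr_eq hmem
    have hloc : (fun ρ => Dr F (ρ, t)) =ᶠ[𝓝 r] fun ρ =>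
      (2 * (1 - (ρ - r0) ^ 2) * (-(2 * (ρ - r0)))) * e * W (ρ, t) +
        (1 - (ρ - r0) ^ 2) ^ 2 * e * Dr W (ρ, t) := by
      filter_upwards [Ioi_mem_nhds (mem_Om.1 hmem).1] with ρ hρ
      exact hdr ρ (mem_Om.2 ⟨hρ, (mem_Om.1 hmem).2⟩)
    apply HasDerivAt.congr_of_eventuallyEq _ hloc
    have := (((zq2 r0 r).mul_const e).mul (hW.hasR hmem)).add (((zq1 r0 r).mul_const e).mul (hW.Dr.hasR hmem))
    exact this.congr_deriv (by ring)
  have hdt : Dt F (r, t) = z ^ 2 * (1 / (t2 - t1)) * W (r, t) + z ^ 2 * e * Dt W (r, t) := by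
    apply hFs.Dt_eq hmem
    have q1 : HasDerivAt (fun x : ℝ => z ^ 2 * ((x - t1) / (t2 - t1)))
        (z ^ 2 * (1 / (t2 - t1))) t :=
      (((hasDerivAt_id t).sub_const t1).div_const (t2 - t1)).const_mul (z ^ 2)
    exact q1.mul (hW.hasT hmem)
  have hl1 := hl.1
  have hl2 := hl.2
  rw [hdr r hmem] at hl1
  rw [hdrr] at hl2
  rw [hdt] at htn
  rw [← hzd] at hl1 hl2
  obtain ⟨k2, k4, k3⟩ := cutoff_alg hz0 hz1 he0 hWpos hzd hl1 hl2 htn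
  have := hyp r t z e hra.le ht.1 ht.2 hz0 hz1 he0 he1 hWpos k2 k4 k3
  linarith

end SDB

namespace SDB
variable {T : ℝ}

noncomputable def H (h : ℝ × ℝ → ℝ) (k : ℕ) : ℝ × ℝ → ℝ := Dr^[k] h

lemma H_succ (h : ℝ × ℝ → ℝ) (k : ℕ) : H h (k + 1) = Dr (H h k) := by
  simp [H, Function.iterate_succ_apply']

lemma H_zero (h : ℝ × ℝ → ℝ) : H h 0 = h := rfl

lemma Sm_H {h : ℝ × ℝ → ℝ} (hh : Sm T h) (k : ℕ) : Sm T (H h k) := by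
  induction k with
  | zero => exact hh
  | succ k ih => rw [H_succ]; exact ih.Dr

/-- polynomials in coth and the space derivatives of order 1..k -/
inductive Pol (h : ℝ × ℝ → ℝ) : ℕ → (ℝ × ℝ → ℝ) → Prop
  | const (k : ℕ) (a : ℝ) : Pol h k (fun _ => a)
  | ct (k : ℕ) : Pol h k SDB.ct
  | H (k j : ℕ) (h1 : 1 ≤ j) (h2 : j ≤ k) : Pol h k (SDB.H h j)
  | add {k : ℕ} {f g : ℝ × ℝ → ℝ} (hf : Pol h k f) (hg : Pol h k g) : Pol h k (fun p => f p + g p)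
  | mul {k : ℕ} {f g : ℝ × ℝ → ℝ} (hf : Pol h k f) (hg : Pol h k g) : Pol h k (fun p => f p * g p)

lemma Pol.mono {h : ℝ × ℝ → ℝ} {k l : ℕ} {f : ℝ × ℝ → ℝ} (hf : Pol h k f) (hkl : k ≤ l) :
    Pol h l f := by
  induction hf with
  | const a => exact .const _ _
  | ct => exact .ct _
  | H j h1 h2 => exact .H _ _ h1 (h2.trans hkl)
  | add _ _ ih1 ih2 => exact .add ih1 ih2
  | mul _ _ ih1 ih2 => exact .mul ih1 ih2

lemma Pol.sm {h : ℝ × ℝ → ℝ} (hh : Sm T h) {k : ℕ} {f : ℝ × ℝ → ℝ} (hf : Pol h k f) : Sm T f := by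
  induction hf with
  | const a => exact Sm.const _
  | ct => exact Sm_ct
  | H j h1 h2 => exact Sm_H hh j
  | add _ _ ih1 ih2 => exact ih1.add ih2
  | mul _ _ ih1 ih2 => exact ih1.mul ih2

lemma Pol.dr {h : ℝ × ℝ → ℝ} (hh : Sm T h) {k : ℕ} {f : ℝ × ℝ → ℝ} (hf : Pol h k f) :
    ∃ e0 e1, Pol h k e0 ∧ Pol h k e1 ∧
      ∀ p ∈ Om T, Dr f p = e0 p + e1 p * SDB.H h (k + 1) p := by
  induction hf with
  | const a =>
    exact ⟨_, _, .const k 0, .const k 0, fun p _ => by rw [Dr_const]; ring⟩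
  | ct =>
    refine ⟨_, _, .add (.const k 1) (.mul (.const k (-1)) (.mul (.ct k) (.ct k))), .const k 0,
      fun p hp => ?_⟩
    rw [Dr_ct hp]; ring
  | H j h1 h2 =>
    rcases Nat.lt_or_ge j k with hjk | hjk
    · refine ⟨_, _, .H k (j + 1) (by omega) (by omega), .const k 0, fun p hp => ?_⟩
      rw [H_succ h j]; ring
    · have : j = k := by omega
      subst this
      refine ⟨_, _, .const j 0, .const j 1, fun p hp => ?_⟩
      rw [H_succ h j]; ring
  | @add f g hf hg ih1 ih2 =>
    obtain ⟨a0, a1, pa0, pa1, ea⟩ := ih1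
    obtain ⟨b0, b1, pb0, pb1, eb⟩ := ih2
    refine ⟨_, _, .add pa0 pb0, .add pa1 pb1, fun p hp => ?_⟩
    rw [(hf.sm hh).Dr_add (hg.sm hh) hp, ea p hp, eb p hp]; ring
  | @mul f g hf hg ih1 ih2 =>
    obtain ⟨a0, a1, pa0, pa1, ea⟩ := ih1
    obtain ⟨b0, b1, pb0, pb1, eb⟩ := ih2
    refine ⟨_, _, .add (.mul pa0 hg) (.mul hf pb0), .add (.mul pa1 hg) (.mul hf pb1),
      fun p hp => ?_⟩
    rw [(hf.sm hh).Dr_mul (hg.sm hh) hp, ea p hp, eb p hp]; ring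

/-- the logarithmic form of the equation -/
def LogEq (T m n : ℝ) (h : ℝ × ℝ → ℝ) : Prop := ∀ p ∈ Om T,
  Dt h p = m * Real.exp ((m - 1) * h p) *
    (H h 2 p + (m * H h 1 p + n * ct p) * H h 1 p)

lemma step {m n : ℝ} {h : ℝ × ℝ → ℝ} (hh : Sm T h) {k : ℕ} {α : ℝ} {B : ℝ × ℝ → ℝ} (hB : Sm T B)
    (he : ∀ p ∈ Om T, Dt (H h k) p = m * Real.exp ((m - 1) * h p) *
      (H h (k + 2) p + (α * H h 1 p + n * ct p) * H h (k + 1) p + B p)) :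
    ∀ p ∈ Om T, Dt (H h (k + 1)) p = m * Real.exp ((m - 1) * h p) *
      (H h (k + 3) p + ((α + (m - 1)) * H h 1 p + n * ct p) * H h (k + 2) p +
        ((α * H h 2 p + n * (1 - ct p * ct p)) * H h (k + 1) p + Dr B p +
        (m - 1) * H h 1 p * ((α * H h 1 p + n * ct p) * H h (k + 1) p + B p))) := by
  intro p hp
  have hP : Sm T (fun p => m * Real.exp ((m - 1) * h p)) :=
    (Sm.const m).mul ((Sm.const (m - 1)).mul hh).exp
  have hA : Sm T (fun p => α * H h 1 p + n * ct p) :=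
    ((Sm.const α).mul (Sm_H hh 1)).add ((Sm.const n).mul Sm_ct)
  have hAH : Sm T (fun p => (α * H h 1 p + n * ct p) * H h (k + 1) p) := hA.mul (Sm_H hh _)
  have hs : Sm T (fun p => H h (k + 2) p + (α * H h 1 p + n * ct p) * H h (k + 1) p) :=
    (Sm_H hh _).add hAH
  have e0 : Dt (H h (k + 1)) p = Dr (Dt (H h k)) p := by
    rw [H_succ]; exact (Sm_H hh k).comm hp
  rw [e0, Dr_congr he p hp, hP.Dr_mul (hs.add hB) hp,
    hs.Dr_add hB hp, (Sm_H hh _).Dr_add hAH hp, hA.Dr_mul (Sm_H hh _) hp,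
    ((Sm.const α).mul (Sm_H hh 1)).Dr_add ((Sm.const n).mul Sm_ct) hp,
    (Sm.const α).Dr_mul (Sm_H hh 1) hp, (Sm.const n).Dr_mul Sm_ct hp, Dr_const, Dr_const,
    Dr_ct hp, (Sm.const m).Dr_mul ((Sm.const (m - 1)).mul hh).exp hp,
    ((Sm.const (m - 1)).mul hh).Dr_exp hp, (Sm.const (m - 1)).Dr_mul hh hp, Dr_const, Dr_const,
    ← H_succ h (k + 2), ← H_succ h (k + 1), ← H_succ h 1]
  have : Dr h p = H h 1 p := by rw [H_succ]; rfl
  rw [this]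
  ring

lemma eq_one {m n : ℝ} {h : ℝ × ℝ → ℝ} (hh : Sm T h) (he : LogEq T m n h) :
    ∀ p ∈ Om T, Dt (H h 1) p = m * Real.exp ((m - 1) * h p) *
      (H h 3 p + ((3 * m - 1) * H h 1 p + n * ct p) * H h 2 p +
        (n * (1 - ct p * ct p) * H h 1 p + (m - 1) * n * ct p * (H h 1 p * H h 1 p)
          + m * (m - 1) * (H h 1 p * (H h 1 p * H h 1 p)))) := by
  intro p hp
  have := step (k := 0) (m := m) (n := n) (α := m) hh (Sm.const 0)
    (fun p hp => by rw [H_zero, he p hp]; ring) p hp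
  rw [this, Dr_const]
  ring

lemma structure_eq {m n : ℝ} {h : ℝ × ℝ → ℝ} (hh : Sm T h) (he : LogEq T m n h) (k : ℕ)
    (hk : 1 ≤ k) : ∃ (α : ℝ) (B : ℝ × ℝ → ℝ), Pol h k B ∧
    (∀ p ∈ Om T, Dt (H h k) p = m * Real.exp ((m - 1) * h p) *
      (H h (k + 2) p + (α * H h 1 p + n * ct p) * H h (k + 1) p + B p)) ∧
    (2 ≤ k → ∃ b0 b1 b2, Pol h (k - 1) b0 ∧ Pol h (k - 1) b1 ∧ Pol h (k - 1) b2 ∧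
      ∀ p ∈ Om T, B p = b0 p + b1 p * H h k p + b2 p * (H h k p) ^ 2) := by
  induction k, hk using Nat.le_induction with
  | base =>
    refine ⟨3 * m - 1, _, ?_, eq_one hh he, by omega⟩
    have c := Pol.ct (h := h) 1
    have q := Pol.H (h := h) 1 1 le_rfl le_rfl
    have c2 : Pol h 1 (fun p => 1 - ct p * ct p) := by
      have := Pol.add (.const 1 1) (.mul (.const 1 (-1)) (.mul c c))
      convert this using 2
      ring
    exact .add (.add (.mul (.mul (.const _ n) c2) q)
      (.mul (.mul (.mul (.const _ (m - 1)) (.const _ n)) c) (.mul q q)))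
      (.mul (.mul (.const _ m) (.const _ (m - 1))) (.mul q (.mul q q)))
  | succ k hk ih =>
    obtain ⟨α, B, pB, eB, -⟩ := ih
    have st := step hh (pB.sm hh) eB
    obtain ⟨e0, e1, p0, p1, ed⟩ := pB.dr hh
    have c := Pol.ct (h := h) k
    have q := Pol.H (h := h) k 1 le_rfl hk
    have c2 : Pol h k (fun p => 1 - ct p * ct p) := by
      have := Pol.add (.const k 1) (.mul (.const k (-1)) (.mul c c))
      convert this using 2
      ring
    have key : ∃ b0 b1 b2, Pol h k b0 ∧ Pol h k b1 ∧ Pol h k b2 ∧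
      ∀ p ∈ Om T, ((α * H h 2 p + n * (1 - ct p * ct p)) * H h (k + 1) p + Dr B p +
        (m - 1) * H h 1 p * ((α * H h 1 p + n * ct p) * H h (k + 1) p + B p))
        = b0 p + b1 p * H h (k + 1) p + b2 p * (H h (k + 1) p) ^ 2 := by
      rcases Nat.lt_or_ge k 2 with hk2 | hk2
      · have : k = 1 := by omega
        subst this
        refine ⟨_, _, _, .add p0 (.mul (.mul (.const _ (m - 1)) q) pB),
          .add (.add (.mul (.const _ n) c2) p1) (.mul (.mul (.const _ (m - 1)) q)
            (.add (.mul (.const _ α) q) (.mul (.const _ n) c))), .const _ α, fun p hp => ?_⟩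
        rw [ed p hp]
        ring
      · refine ⟨_, _, _, .add p0 (.mul (.mul (.const _ (m - 1)) q) pB),
          .add (.mul (.const _ α) (.H k 2 (by norm_num) hk2))
          (.add (.add (.mul (.const _ n) c2) p1) (.mul (.mul (.const _ (m - 1)) q)
            (.add (.mul (.const _ α) q) (.mul (.const _ n) c)))), .const _ 0, fun p hp => ?_⟩
        rw [ed p hp]
        ring
    obtain ⟨b0, b1, b2, q0, q1, q2, eb⟩ := key
    have r := Pol.H (h := h) (k + 1) (k + 1) (by omega) le_rfl
    refine ⟨α + (m - 1), fun p => b0 p + b1 p * H h (k + 1) p + b2 p * (H h (k + 1) p) ^ 2,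
      ?_, ?_, fun _ => ⟨b0, b1, b2, q0, q1, q2, fun p _ => rfl⟩⟩
    · simp only [pow_two]
      have l := Nat.le_succ k
      exact .add (.add (q0.mono l) (.mul (q1.mono l) r)) (.mul (q2.mono l) (.mul r r))
    · intro p hp
      rw [st p hp, eb p hp]

/-- bounded on `r ≥ 1`, locally uniformly in time -/
def Bdd (T : ℝ) (f : ℝ × ℝ → ℝ) : Prop := ∀ t1 t2, 0 < t1 → t1 ≤ t2 → t2 < T →
  ∃ C, 0 ≤ C ∧ ∀ r t, 1 ≤ r → t1 ≤ t → t ≤ t2 → |f (r, t)| ≤ C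

lemma Pol.bdd {h : ℝ × ℝ → ℝ} {k : ℕ} {f : ℝ × ℝ → ℝ} (hf : Pol h k f)
    (hb : ∀ j, 1 ≤ j → j ≤ k → Bdd T (SDB.H h j)) : Bdd T f := by
  induction hf with
  | const a => exact fun t1 t2 _ _ _ => ⟨|a|, abs_nonneg _, fun _ _ _ _ _ => le_rfl⟩
  | ct =>
    refine fun t1 t2 _ _ _ => ⟨4, by norm_num, fun r t hr _ _ => ?_⟩
    rw [abs_of_nonneg (by linarith [ct_one_le (t := t) (by linarith : 0 < r)])]
    exact ct_le_four hr
  | H j h1 h2 => exact hb j h1 h2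
  | add _ _ ih1 ih2 =>
    intro t1 t2 a b c
    obtain ⟨C1, c1, k1⟩ := ih1 t1 t2 a b c
    obtain ⟨C2, c2, k2⟩ := ih2 t1 t2 a b c
    exact ⟨C1 + C2, by positivity, fun r t x y z =>
      (abs_add_le _ _).trans (add_le_add (k1 r t x y z) (k2 r t x y z))⟩
  | mul _ _ ih1 ih2 =>
    intro t1 t2 a b c
    obtain ⟨C1, c1, k1⟩ := ih1 t1 t2 a b c
    obtain ⟨C2, c2, k2⟩ := ih2 t1 t2 a b c
    refine ⟨C1 * C2, by positivity, fun r t x y z => ?_⟩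
    rw [abs_mul]
    exact mul_le_mul (k1 r t x y z) (k2 r t x y z) (abs_nonneg _) c1

lemma Pol.dt {m n : ℝ} {h : ℝ × ℝ → ℝ} (hh : Sm T h) (he : LogEq T m n h) {k : ℕ}
    {f : ℝ × ℝ → ℝ} (hf : Pol h k f) :
    ∃ g, Pol h (k + 2) g ∧ ∀ p ∈ Om T, Dt f p = Real.exp ((m - 1) * h p) * g p := by
  induction hf with
  | const a =>
    exact ⟨_, .const _ 0, fun p _ => by rw [Dt_const]; ring⟩
  | ct =>
    exact ⟨_, .const _ 0, fun p hp => by rw [Dt_ct hp]; ring⟩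
  | H j h1 h2 =>
    obtain ⟨α, B, pB, eB, -⟩ := structure_eq hh he j h1
    refine ⟨_, .mul (.const _ m) (.add (.add (.H (k + 2) (j + 2) (by omega) (by omega))
      (.mul (.add (.mul (.const _ α) (.H _ 1 le_rfl (by omega))) (.mul (.const _ n) (.ct _)))
      (.H _ (j + 1) (by omega) (by omega)))) (pB.mono (by omega))), fun p hp => ?_⟩
    rw [eB p hp]; ring
  | @add f g hf hg ih1 ih2 =>
    obtain ⟨a, pa, ea⟩ := ih1
    obtain ⟨b, pb, eb⟩ := ih2
    refine ⟨_, .add pa pb, fun p hp => ?_⟩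
    rw [(hf.sm hh).Dt_add (hg.sm hh) hp, ea p hp, eb p hp]; ring
  | @mul f g hf hg ih1 ih2 =>
    obtain ⟨a, pa, ea⟩ := ih1
    obtain ⟨b, pb, eb⟩ := ih2
    refine ⟨_, .add (.mul pa (hg.mono (by omega))) (.mul (hf.mono (by omega)) pb), fun p hp => ?_⟩
    rw [(hf.sm hh).Dt_mul (hg.sm hh) hp, ea p hp, eb p hp]; ring

end SDB

namespace SDB
variable {T : ℝ}

lemma sol_sm {N : ℕ} {m : ℝ} {u : ℝ → ℝ → ℝ} (hu : IsRadialEnergySolution N m T u) :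
    Sm T (fun p => Real.log (u p.1 p.2)) := by
  have h1 : ContDiffOn ℝ (⊤ : ℕ∞) (fun p : ℝ × ℝ => u p.1 p.2) (Om T) :=
    hu.smooth.mono (Set.prod_mono Ioi_subset_Ici_self le_rfl)
  exact h1.log (fun p hp => (hu.pos _ (Ioi_subset_Ici_self hp.1) _ hp.2).ne')

lemma sol_exp {N : ℕ} {m : ℝ} {u : ℝ → ℝ → ℝ} (hu : IsRadialEnergySolution N m T u)
    {r t : ℝ} (hp : (r, t) ∈ Om T) : u r t = Real.exp (Real.log (u r t)) := by
  rw [Real.exp_log (hu.pos _ (Ioi_subset_Ici_self hp.1) _ hp.2)]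

lemma sol_pow {N : ℕ} {m : ℝ} {u : ℝ → ℝ → ℝ} (hu : IsRadialEnergySolution N m T u)
    {r t : ℝ} (hp : (r, t) ∈ Om T) : u r t ^ m = Real.exp (m * Real.log (u r t)) := by
  rw [Real.rpow_def_of_pos (hu.pos _ (Ioi_subset_Ici_self hp.1) _ hp.2), mul_comm]

lemma sol_d1 {N : ℕ} {m : ℝ} {u : ℝ → ℝ → ℝ} (hu : IsRadialEnergySolution N m T u)
    {r t : ℝ} (hp : (r, t) ∈ Om T) : HasDerivAt (fun ρ => u ρ t ^ m)
      (Dr (fun p => Real.exp (m * Real.log (u p.1 p.2))) (r, t)) r := by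
  have hs : Sm T (fun p => Real.exp (m * Real.log (u p.1 p.2))) := ((Sm.const m).mul (sol_sm hu)).exp
  apply (hs.hasR hp).congr_of_eventuallyEq
  filter_upwards [Ioi_mem_nhds (mem_Om.1 hp).1] with ρ hρ
  exact sol_pow hu (mem_Om.2 ⟨hρ, (mem_Om.1 hp).2⟩)

lemma sol_log {N : ℕ} {m : ℝ} {u : ℝ → ℝ → ℝ} (hu : IsRadialEnergySolution N m T u) :
    LogEq T m ((N : ℝ) - 1) (fun p => Real.log (u p.1 p.2)) := by
  rintro ⟨r, t⟩ hp
  have hp' := mem_Om.1 hp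
  have hpde := hu.pde r hp'.1 t ⟨hp'.2.1, hp'.2.2⟩
  have hh := sol_sm hu
  set h : ℝ × ℝ → ℝ := fun p => Real.log (u p.1 p.2) with hdef
  have hs : Sm T (fun p => Real.exp (m * h p)) := ((Sm.const m).mul hh).exp
  have e1 : deriv (fun τ => u r τ) t = Real.exp (h (r, t)) * Dt h (r, t) := by
    rw [← hh.Dt_exp hp]
    apply HasDerivAt.deriv
    apply (hh.exp.hasT hp).congr_of_eventuallyEq
    filter_upwards [Ioo_mem_nhds hp'.2.1 hp'.2.2] with τ hτ
    exact sol_exp hu (mem_Om.2 ⟨hp'.1, hτ⟩)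
  have e3 : deriv (deriv (fun ρ => u ρ t ^ m)) r = Dr (Dr (fun p => Real.exp (m * h p))) (r, t) := by
    apply HasDerivAt.deriv
    apply (hs.Dr.hasR hp).congr_of_eventuallyEq
    filter_upwards [Ioi_mem_nhds hp'.1] with ρ hρ
    exact (sol_d1 hu (mem_Om.2 ⟨hρ, hp'.2⟩)).deriv
  have d1 : ∀ p ∈ Om T, Dr (fun p => Real.exp (m * h p)) p = Real.exp (m * h p) * (m * H h 1 p) := by
    intro p hp
    rw [((Sm.const m).mul hh).Dr_exp hp, (Sm.const m).Dr_mul hh hp, Dr_const, H_succ, H_zero]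
    ring
  have d2 : Dr (Dr (fun p => Real.exp (m * h p))) (r, t) = Real.exp (m * h (r,t)) *
      (m * H h 2 (r, t) + m ^ 2 * H h 1 (r, t) ^ 2) := by
    rw [Dr_congr d1 _ hp, hs.Dr_mul ((Sm.const m).mul (Sm_H hh 1)) hp, d1 _ hp,
      (Sm.const m).Dr_mul (Sm_H hh 1) hp, Dr_const, H_succ h 1]
    ring
  rw [e1, e3, (sol_d1 hu hp).deriv, d2, d1 _ hp] at hpde
  have e4 : Real.exp (m * h (r, t)) = Real.exp ((m - 1) * h (r,t)) * Real.exp (h (r,t)) := by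
    rw [← Real.exp_add]; ring_nf
  have e5 := Real.exp_pos (h (r,t))
  have e6 : Real.exp (h (r,t)) * Dt h (r,t) = Real.exp (h (r,t)) * (m * Real.exp ((m - 1) * h (r, t)) *
    (H h 2 (r, t) + (m * H h 1 (r, t) + ((N : ℝ) - 1) * ct (r, t)) * H h 1 (r, t))) := by
    rw [hpde, e4, ct]; ring
  exact mul_left_cancel₀ e5.ne' e6

lemma sinh_ge {r : ℝ} (hr : 1 ≤ r) : Real.exp r / 4 ≤ Real.sinh r := by
  rw [Real.sinh_eq]
  have e2 : Real.exp r * Real.exp (-r) = 1 := by rw [← Real.exp_add]; simp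
  have h2 : (2 : ℝ) ≤ Real.exp r := by linarith [Real.add_one_le_exp r]
  have := Real.exp_pos (-r)
  have h3 : Real.exp (-r) ≤ 1 / 2 := by nlinarith
  linarith

lemma radial {k : ℕ} {v v' : ℝ → ℝ} {C : ℝ}
    (hd : ∀ r, 0 < r → HasDerivAt v (v' r) r) (hc : ContinuousOn v' (Ioi 0))
    (i1 : IntegrableOn (fun s => (v s) ^ 2 * Real.sinh s ^ k) (Ioi 0))
    (i2 : IntegrableOn (fun s => (deriv v s) ^ 2 * Real.sinh s ^ k) (Ioi 0))
    (hC : (∫ s in Ioi (0:ℝ), (v s) ^ 2 * Real.sinh s ^ k) +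
      (∫ s in Ioi (0:ℝ), (deriv v s) ^ 2 * Real.sinh s ^ k) ≤ C) {r : ℝ} (hr : 0 < r) :
    v r ^ 2 * Real.sinh r ^ k ≤ C := by
  have hS : 0 < Real.sinh r ^ k := pow_pos (Real.sinh_pos_iff.2 hr) k
  set S := Real.sinh r ^ k with hSd
  have hnn : ∀ (g : ℝ → ℝ), ∀ s ∈ Ioi (0:ℝ), 0 ≤ g s ^ 2 * Real.sinh s ^ k := fun g s hs =>
    mul_nonneg (sq_nonneg _) (pow_nonneg (Real.sinh_pos_iff.2 hs).le k)
  -- sum integrand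
  have i3 : IntegrableOn (fun s => (v s ^ 2 + deriv v s ^ 2) * Real.sinh s ^ k) (Ioi 0) := by
    have := i1.add i2
    refine this.congr_fun (fun s _ => ?_) measurableSet_Ioi
    simp; ring
  have hC3 : ∫ s in Ioi (0:ℝ), (v s ^ 2 + deriv v s ^ 2) * Real.sinh s ^ k ≤ C := by
    refine le_trans (le_of_eq ?_) hC
    rw [← integral_add i1 i2]
    congr 1; ext s; ring
  have hcv : ContinuousOn v (Ioi 0) := fun s hs => (hd s hs).continuousAt.continuousWithinAt
  have key : ∀ b, r ≤ b → ∫ s in r..b, (v s ^ 2 + v' s ^ 2) ≤ C / S := by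
    intro b hb
    have hsub : Icc r b ⊆ Ioi 0 := fun x hx => lt_of_lt_of_le hr hx.1
    rw [le_div_iff₀ hS, ← intervalIntegral.integral_mul_const]
    have : ∫ s in r..b, (v s ^ 2 + v' s ^ 2) * S ≤ ∫ s in r..b, (v s ^ 2 + v' s ^ 2) * Real.sinh s ^ k := by
      apply intervalIntegral.integral_mono_on hb
      · apply ContinuousOn.intervalIntegrable
        rw [uIcc_of_le hb]
        exact (((hcv.mono hsub).pow 2).add ((hc.mono hsub).pow 2)).mul continuousOn_const
      · apply ContinuousOn.intervalIntegrable
        rw [uIcc_of_le hb]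
        exact (((hcv.mono hsub).pow 2).add ((hc.mono hsub).pow 2)).mul
          (Real.continuous_sinh.pow k).continuousOn
      · intro x hx
        apply mul_le_mul_of_nonneg_left _ (by positivity)
        exact pow_le_pow_left₀ (Real.sinh_pos_iff.2 hr).le (Real.sinh_le_sinh.2 hx.1) k
    refine this.trans (le_trans ?_ hC3)
    rw [intervalIntegral.integral_of_le hb]
    have e : ∫ s in Ioc r b, (v s ^ 2 + v' s ^ 2) * Real.sinh s ^ k
       = ∫ s in Ioc r b, (v s ^ 2 + deriv v s ^ 2) * Real.sinh s ^ k := by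
      apply setIntegral_congr_fun measurableSet_Ioc
      intro s hs
      simp only
      rw [(hd s (lt_trans hr hs.1)).deriv]
    rw [e]
    apply setIntegral_mono_set i3
    · filter_upwards [ae_restrict_mem measurableSet_Ioi] with s hs
      have := hnn v s hs; have := hnn (deriv v) s hs
      simp only [Pi.zero_apply]
      linarith
    · exact (Filter.Eventually.of_forall (fun s hs => lt_trans hr hs.1))
  have key2 : ∀ b, r ≤ b → v r ^ 2 - v b ^ 2 ≤ C / S := by
    intro b hb
    have hsub : Icc r b ⊆ Ioi 0 := fun x hx => lt_of_lt_of_le hr hx.1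
    have ft : ∫ s in r..b, (-(2 * v s * v' s)) = -(v b ^ 2) - -(v r ^ 2) := by
      apply intervalIntegral.integral_eq_sub_of_hasDerivAt
      · intro x hx
        rw [uIcc_of_le hb] at hx
        exact ((hd x (hsub hx)).pow 2).neg.congr_deriv (by norm_num)
      · apply ContinuousOn.intervalIntegrable
        rw [uIcc_of_le hb]
        exact ((continuousOn_const.mul (hcv.mono hsub)).mul (hc.mono hsub)).neg
    have : ∫ s in r..b, (-(2 * v s * v' s)) ≤ ∫ s in r..b, (v s ^ 2 + v' s ^ 2) := by
      apply intervalIntegral.integral_mono_on hb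
      · apply ContinuousOn.intervalIntegrable
        rw [uIcc_of_le hb]
        exact ((continuousOn_const.mul (hcv.mono hsub)).mul (hc.mono hsub)).neg
      · apply ContinuousOn.intervalIntegrable
        rw [uIcc_of_le hb]
        exact (((hcv.mono hsub).pow 2).add ((hc.mono hsub).pow 2))
      · intro x hx
        nlinarith [sq_nonneg (v x + v' x)]
    linarith [key b hb]
  by_contra hcon
  push Not at hcon
  have hδ : 0 < v r ^ 2 - C / S := by
    rw [sub_pos, div_lt_iff₀ hS]; exact hcon
  set δ := v r ^ 2 - C / S with hδd
  have hC0 : 0 ≤ C / S := by simpa using key r le_rfl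
  have hL := key (r + (C / S + 1) / δ) (by have : 0 < (C / S + 1) / δ := by positivity
                                           linarith)
  have hle : r ≤ r + (C / S + 1) / δ := by
    have : 0 < (C / S + 1) / δ := by positivity
    linarith
  have hsub : Icc r (r + (C / S + 1) / δ) ⊆ Ioi 0 := fun x hx => lt_of_lt_of_le hr hx.1
  have : ∫ s in r..(r + (C / S + 1) / δ), δ ≤ ∫ s in r..(r + (C / S + 1) / δ), (v s ^ 2 + v' s ^ 2) := by
    apply intervalIntegral.integral_mono_on hle
    · simp
    · apply ContinuousOn.intervalIntegrable
      rw [uIcc_of_le hle]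
      exact (((hcv.mono hsub).pow 2).add ((hc.mono hsub).pow 2))
    · intro x hx
      have := key2 x hx.1
      nlinarith [sq_nonneg (v' x)]
  simp only [intervalIntegral.integral_const, smul_eq_mul, add_sub_cancel_left] at this
  rw [div_mul_cancel₀ _ hδ.ne'] at this
  linarith

lemma apriori {N : ℕ} (hN : 3 ≤ N) {m : ℝ} {u : ℝ → ℝ → ℝ} (hu : IsRadialEnergySolution N m T u)
    {t1 : ℝ} (h1 : 0 < t1) (hT : t1 < T) : ∃ V0, 1 ≤ V0 ∧ ∀ r t, 1 ≤ r → t1 ≤ t → t < T →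
      Real.exp (m * Real.log (u r t)) ≤ V0 * Real.exp (-(((N : ℝ) - 1) / 2) * r) := by
  obtain ⟨C, hC⟩ := hu.energy_bdd t1 ⟨h1, hT⟩
  refine ⟨(C + 1) ^ 2 * 4 ^ (N - 1) + 1, ?_, ?_⟩
  · have : (0:ℝ) ≤ (C + 1) ^ 2 * 4 ^ (N - 1) := by positivity
    linarith
  intro r t hr ht htT
  have hr0 : 0 < r := by linarith
  have ht0 : 0 < t := by linarith
  have hs : Sm T (fun p => Real.exp (m * Real.log (u p.1 p.2))) := ((Sm.const m).mul (sol_sm hu)).exp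
  have hE := hu.energy t ⟨ht0, htT⟩
  have hq := radial (k := N - 1) (v := fun ρ => u ρ t ^ m)
    (v' := fun r => Dr (fun p => Real.exp (m * Real.log (u p.1 p.2))) (r, t)) (C := C)
    (fun r hr => sol_d1 hu (mem_Om.2 ⟨hr, ht0, htT⟩))
    (hs.Dr.cont.comp (Continuous.continuousOn (by fun_prop)) (fun r hr => mem_Om.2 ⟨hr, ht0, htT⟩))
    hE.2.1 hE.2.2 (hC t ⟨ht, htT⟩) hr0
  simp only [sol_pow hu (mem_Om.2 ⟨hr0, ht0, htT⟩)] at hq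
  set v := Real.exp (m * Real.log (u r t)) with hv
  have hv0 : 0 < v := Real.exp_pos _
  have hsg := pow_le_pow_left₀ (by positivity) (sinh_ge hr) (N - 1)
  have hC0 : 0 ≤ C := le_trans (by have := Real.sinh_pos_iff.2 hr0; positivity) hq
  have hcast : ((N - 1 : ℕ) : ℝ) = (N : ℝ) - 1 := by rw [Nat.cast_sub (by omega)]; simp
  set E := Real.exp (-(((N : ℝ) - 1) / 2) * r) with hEd
  have hE0 : 0 < E := Real.exp_pos _
  have hE2 : (Real.exp r) ^ (N - 1) * E ^ 2 = 1 := by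
    rw [← Real.exp_nat_mul, ← Real.exp_nat_mul, ← Real.exp_add, hcast, Real.exp_eq_one_iff]
    push_cast; ring
  have h4 : (1:ℝ) ≤ 4 ^ (N - 1) := one_le_pow₀ (by norm_num)
  set F := (4:ℝ) ^ (N - 1) with hF
  set X := (Real.exp r) ^ (N - 1) with hX
  have hX0 : 0 < X := by positivity
  rw [div_pow] at hsg
  have a1 : v ^ 2 * (X / F) ≤ C := (mul_le_mul_of_nonneg_left hsg (by positivity)).trans hq
  have a2 : v ^ 2 ≤ C * F * E ^ 2 := by
    have a3 : v ^ 2 * X ≤ C * F := by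
      rw [← mul_div_assoc, div_le_iff₀ (by linarith)] at a1; exact a1
    calc v ^ 2 = v ^ 2 * X * E ^ 2 := by rw [mul_assoc, hE2, mul_one]
      _ ≤ _ := by gcongr
  apply le_of_sq_le_sq _ (by positivity)
  rw [mul_pow]
  refine a2.trans ?_
  gcongr
  have b1 : C ≤ (C + 1) ^ 2 := by nlinarith
  have b2 : C * F ≤ (C + 1) ^ 2 * F := by gcongr
  have b3 : 0 ≤ (C + 1) ^ 2 * F := by positivity
  nlinarith
end SDB

namespace SDB
variable {T : ℝ}

lemma bern1_alg {m n a b c3 ct z e M P0 d : ℝ} (hm0 : 0 < m) (hm1 : m < 1) (hn : 0 ≤ n)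
    (hc1 : 1 ≤ ct) (hc2 : ct ≤ 4) (hz : 0 < z) (hz1 : z ≤ 1) (he : 0 < e) (he1 : e ≤ 1)
    (hP0 : 0 < P0) (hM : P0 ≤ M) (hd : 0 < d) (ha : 0 < a ^ 2)
    (k1 : z ^ 2 * (2 * b ^ 2 + 2 * a * c3) ≤ 28 * a ^ 2) (k2 : z * |2 * a * b| ≤ 4 * a ^ 2)
    (k3 : 0 ≤ a ^ 2 / d + e * (2 * a * (M * (c3 + ((3 * m - 1) * a + n * ct) * b +
        (n * (1 - ct * ct) * a + (m - 1) * n * ct * (a * a)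
          + m * (m - 1) * (a * (a * a))))))) :
    z ^ 2 * e * a ^ 2 ≤ (1 / (d * P0) + 28 + 16 * n) / (m * (1 - m))
      + ((8 + 8 * n) / (2 * (m * (1 - m)))) ^ 2 := by
  have hM0 : 0 < M := lt_of_lt_of_le hP0 hM
  have hab : |a| ^ 2 = a ^ 2 := sq_abs a
  have ha0 : 0 < |a| := by
    rcases (abs_nonneg a).lt_or_eq with h | h
    · exact h
    · rw [← h] at hab; norm_num at hab; linarith
  have hzb : z * |b| ≤ 2 * |a| := by
    have : z * |b| * |a| ≤ 2 * |a| * |a| := by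
      rw [abs_mul, abs_mul] at k2
      norm_num at k2
      nlinarith
    exact le_of_mul_le_mul_right this ha0
  -- divide by M
  set A := (3 * m - 1) * a + n * ct with hA
  set Bq := n * (1 - ct * ct) * a + (m - 1) * n * ct * (a * a) + m * (m - 1) * (a * (a * a)) with hB
  have k4 : 0 ≤ a ^ 2 * (1 / (d * P0)) + e * (2 * a * c3 + 2 * a * (A * b) + 2 * a * Bq) := by
    have e1 : 0 ≤ (a ^ 2 / d + e * (2 * a * (M * (c3 + A * b + Bq)))) / M := div_nonneg k3 hM0.le
    have e2 : (a ^ 2 / d + e * (2 * a * (M * (c3 + A * b + Bq)))) / M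
        = a ^ 2 * (1 / (d * M)) + e * (2 * a * c3 + 2 * a * (A * b) + 2 * a * Bq) := by
      field_simp
    rw [e2] at e1
    have e3 : 1 / (d * M) ≤ 1 / (d * P0) := by gcongr
    have e4 := mul_le_mul_of_nonneg_left e3 ha.le
    linarith
  set κ := 1 / (d * P0) with hκ
  have hκ0 : 0 < κ := by positivity
  have hAb : |A| ≤ 2 * |a| + 4 * n := by
    rw [hA]
    refine (abs_add_le _ _).trans (add_le_add ?_ ?_)
    · rw [abs_mul]
      gcongr
      rw [abs_le]; constructor <;> linarith
    · rw [abs_of_nonneg (by positivity)]; linarith [mul_le_mul_of_nonneg_left hc2 hn]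
  have t1 : z ^ 2 * (2 * a * (A * b)) ≤ 4 * z * |a| ^ 2 * (2 * |a| + 4 * n) := by
    calc z ^ 2 * (2 * a * (A * b)) ≤ |z ^ 2 * (2 * a * (A * b))| := le_abs_self _
      _ = 2 * z * |a| * |A| * (z * |b|) := by
        rw [abs_mul, abs_mul, abs_mul, abs_mul]; rw [abs_of_pos (pow_pos hz 2)]; norm_num; ring
      _ ≤ 2 * z * |a| * (2 * |a| + 4 * n) * (2 * |a|) := by gcongr
      _ = _ := by ring
  have t2 : a * Bq ≤ 4 * n * |a| ^ 3 - m * (1 - m) * |a| ^ 4 := by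
    have s1 : a * Bq = n * (1 - ct * ct) * a ^ 2 + (m - 1) * n * ct * a ^ 3 - m * (1 - m) * a ^ 4 := by
      rw [hB]; ring
    have s2 : n * (1 - ct * ct) * a ^ 2 ≤ 0 := by
      have : 0 ≤ n * a ^ 2 * (ct * ct - 1) := mul_nonneg (by positivity) (by nlinarith)
      linarith
    have s3 : (m - 1) * n * ct * a ^ 3 ≤ 4 * n * |a| ^ 3 := by
      calc (m - 1) * n * ct * a ^ 3 ≤ |(m - 1) * n * ct * a ^ 3| := le_abs_self _
        _ = |m - 1| * n * ct * |a| ^ 3 := by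
          rw [abs_mul, abs_mul, abs_mul, abs_pow, abs_of_nonneg hn, abs_of_pos (by linarith : 0 < ct)]
        _ ≤ 1 * n * 4 * |a| ^ 3 := by
          gcongr
          rw [abs_le]; constructor <;> linarith
        _ = _ := by ring
    have s4 : |a| ^ 4 = a ^ 4 := by
      rw [show |a| ^ 4 = (|a| ^ 2) ^ 2 by ring, hab]; ring
    rw [s1, s4]; linarith
  -- combine
  have hz2 : z ^ 2 ≤ 1 := pow_le_one₀ hz.le hz1
  set x := |a| with hx
  have k5 : 0 ≤ x ^ 2 * κ + e * (28 * x ^ 2 + 4 * z * x ^ 2 * (2 * x + 4 * n)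
      + 2 * z ^ 2 * (4 * n * x ^ 3 - m * (1 - m) * x ^ 4)) := by
    have s0 := mul_nonneg (sq_nonneg z) k4
    have s1 : z ^ 2 * (2 * a * c3 + 2 * a * (A * b) + 2 * a * Bq) ≤ 28 * x ^ 2 + 4 * z * x ^ 2 * (2 * x + 4 * n)
      + 2 * z ^ 2 * (4 * n * x ^ 3 - m * (1 - m) * x ^ 4) := by
      rw [hab] at *
      have := mul_le_mul_of_nonneg_left t2 (sq_nonneg z)
      have : 0 ≤ z ^ 2 * b ^ 2 := by positivity
      linarith
    have s2 := mul_le_mul_of_nonneg_left s1 he.le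
    have s3 : z ^ 2 * (a ^ 2 * κ) ≤ 1 * (a ^ 2 * κ) := by gcongr
    rw [hab] at s2 ⊢
    linarith
  have k6 : 0 ≤ κ + e * (28 + 4 * z * (2 * x + 4 * n) + 2 * z ^ 2 * (4 * n * x - m * (1 - m) * x ^ 2)) := by
    have : 0 ≤ x ^ 2 * (κ + e * (28 + 4 * z * (2 * x + 4 * n) + 2 * z ^ 2 * (4 * n * x - m * (1 - m) * x ^ 2))) := by
      linarith
    exact nonneg_of_mul_nonneg_right this (by positivity)
  set μ := m * (1 - m) with hμ
  have hμ0 : 0 < μ := mul_pos hm0 (by linarith)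
  set y := e * z * x with hy
  have hy0 : 0 ≤ y := by positivity
  have k7 : 2 * μ * (z ^ 2 * e * x ^ 2) ≤ κ + 28 + 16 * n + (8 + 8 * n) * y := by
    have s1 : e * 28 ≤ 28 := by linarith
    have s2 : e * (16 * z * n) ≤ 16 * n := by
      have : e * z ≤ 1 := mul_le_one₀ he1 hz.le hz1
      linarith [mul_le_mul_of_nonneg_left this hn]
    have s3 : e * (z ^ 2 * (8 * n * x)) ≤ 8 * n * y := by
      have : 0 ≤ 8 * n * y * (1 - z) := mul_nonneg (by positivity) (by linarith)
      rw [hy] at this ⊢; linarith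
    rw [hy] at s3 ⊢
    linarith
  have k8 : y ^ 2 ≤ z ^ 2 * e * x ^ 2 := by
    rw [hy, show (e * z * x) ^ 2 = e * (z ^ 2 * e * x ^ 2) by ring]
    have : 0 ≤ z ^ 2 * e * x ^ 2 := by positivity
    exact mul_le_of_le_one_left this he1
  rw [← hab]
  set Y := z ^ 2 * e * x ^ 2
  set L := (8 + 8 * n) / (2 * μ) with hL
  have hL2 : (8 + 8 * n) = 2 * μ * L := by rw [hL]; field_simp
  have k9 : (8 + 8 * n) * y ≤ μ * (Y + L ^ 2) := by
    rw [hL2]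
    have := mul_le_mul_of_nonneg_left (sq_nonneg (y - L)) hμ0.le
    have := mul_le_mul_of_nonneg_left k8 hμ0.le
    linarith
  have : Y - L ^ 2 ≤ (κ + 28 + 16 * n) / μ := by
    rw [le_div_iff₀ hμ0]; linarith
  linarith

lemma bern2_S {w w1 q A B R K Q c : ℝ} (hq : |q| ≤ Q) (hK : K = 32 * Q ^ 2 + 1) (hc : 0 ≤ c)
    (hA : |A| ≤ c) (hB : |B| ≤ c * (1 + w ^ 2)) (hR : |R| ≤ c * (1 + |w|)) :
    2 * w * (K + q ^ 2) * (A * w1 + B) + 2 * w ^ 2 * q * (w1 + R) - 2 * w1 ^ 2 * (K + q ^ 2)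
      - 10 * w ^ 2 * w1 * q - 2 * w ^ 4 ≤ - w ^ 4 / 2 +
      (81 * ((K + Q ^ 2) * (c ^ 2 + 2 * c) + 2 * Q * c) ^ 4
        + 3 * ((K + Q ^ 2) * (c ^ 2 + 2 * c) + 2 * Q * c)) := by
  have hQ : 0 ≤ Q := (abs_nonneg q).trans hq
  have hq2 : q ^ 2 ≤ Q ^ 2 := by rw [← sq_abs]; gcongr
  set φ := K + q ^ 2 with hφ
  set Φ := K + Q ^ 2 with hΦ
  have hφΦ : φ ≤ Φ := by linarith
  have hΦ0 : 0 < Φ := by rw [hΦ, hK]; positivity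
  have hφ0 : 0 < φ := by rw [hφ, hK]; positivity
  have hφK : 32 * Q ^ 2 ≤ φ := by rw [hφ, hK]; nlinarith [sq_nonneg q]
  set x := |w| with hx
  have hx0 : 0 ≤ x := abs_nonneg w
  have hx2 : x ^ 2 = w ^ 2 := sq_abs w
  have hx4 : x ^ 4 = w ^ 4 := by rw [show x ^ 4 = (x ^ 2) ^ 2 by ring, hx2]; ring
  have t1 : -8 * w ^ 2 * w1 * q ≤ w ^ 4 / 2 + φ * w1 ^ 2 := by
    have s1 : -8 * w ^ 2 * w1 * q ≤ w ^ 4 / 2 + 32 * (w1 * q) ^ 2 := by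
      linarith [sq_nonneg (w ^ 2 + 8 * (w1 * q))]
    have s2 : 32 * (w1 * q) ^ 2 ≤ φ * w1 ^ 2 := by
      rw [mul_pow]
      linarith [mul_le_mul_of_nonneg_left hφK (sq_nonneg w1), mul_le_mul_of_nonneg_left hq2 (sq_nonneg w1)]
    linarith
  have t2 : 2 * w * φ * (A * w1) ≤ φ * w1 ^ 2 + Φ * c ^ 2 * x ^ 2 := by
    have s1 : A ^ 2 ≤ c ^ 2 := by rw [← sq_abs]; gcongr
    have s2 : 2 * w * φ * (A * w1) ≤ φ * w1 ^ 2 + φ * A ^ 2 * w ^ 2 := by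
      have := mul_le_mul_of_nonneg_left (sq_nonneg (w1 - A * w)) hφ0.le
      linarith
    have s3 : φ * A ^ 2 * w ^ 2 ≤ Φ * c ^ 2 * x ^ 2 := by rw [hx2]; gcongr
    linarith
  have t3 : 2 * w * φ * B ≤ 2 * Φ * c * (x + x ^ 3) := by
    calc 2 * w * φ * B ≤ |2 * w * φ * B| := le_abs_self _
      _ = 2 * x * φ * |B| := by rw [abs_mul, abs_mul, abs_mul, abs_of_pos hφ0, abs_two]
      _ ≤ 2 * x * Φ * (c * (1 + w ^ 2)) := by gcongr
      _ = _ := by rw [← hx2]; ring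
  have t4 : 2 * w ^ 2 * q * R ≤ 2 * Q * c * (x ^ 2 + x ^ 3) := by
    calc 2 * w ^ 2 * q * R ≤ |2 * w ^ 2 * q * R| := le_abs_self _
      _ = 2 * x ^ 2 * |q| * |R| := by rw [abs_mul, abs_mul, abs_mul, abs_pow, abs_two]
      _ ≤ 2 * x ^ 2 * Q * (c * (1 + x)) := by gcongr
      _ = _ := by ring
  set c1 := Φ * (c ^ 2 + 2 * c) + 2 * Q * c with hc1
  have hc10 : 0 ≤ c1 := by positivity
  have u1 : x ≤ 1 + x ^ 3 := by nlinarith [mul_nonneg hx0 (sq_nonneg (x - 1)), sq_nonneg (x-1)]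
  have u2 : x ^ 2 ≤ 1 + x ^ 3 := by nlinarith [mul_nonneg hx0 (sq_nonneg (x - 1)), sq_nonneg (x-1)]
  have u3 : 3 * c1 * x ^ 3 ≤ x ^ 4 + 81 * c1 ^ 4 := by
    rcases le_total (3 * c1) x with h | h
    · have : 3 * c1 * x ^ 3 ≤ x * x ^ 3 := by gcongr
      linarith [pow_nonneg hc10 4]
    · have : 3 * c1 * x ^ 3 ≤ 3 * c1 * (3 * c1) ^ 3 := by gcongr
      linarith [pow_nonneg hx0 4]
  have t5 : Φ * c ^ 2 * x ^ 2 + 2 * Φ * c * (x + x ^ 3) + 2 * Q * c * (x ^ 2 + x ^ 3) ≤ 3 * c1 * (1 + x ^ 3) := by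
    have a1 : Φ * c ^ 2 * x ^ 2 ≤ Φ * c ^ 2 * (3 * (1 + x ^ 3)) := by
      gcongr; linarith [pow_nonneg hx0 3]
    have a2 : 2 * Φ * c * (x + x ^ 3) ≤ 2 * Φ * c * (3 * (1 + x ^ 3)) := by
      gcongr; linarith [pow_nonneg hx0 3]
    have a3 : 2 * Q * c * (x ^ 2 + x ^ 3) ≤ 2 * Q * c * (3 * (1 + x ^ 3)) := by
      gcongr; linarith [pow_nonneg hx0 3]
    rw [hc1]; linarith
  linarith

lemma bern2_alg {w w1 w2 q A B R K Q c z e M P0 d : ℝ} (hq : |q| ≤ Q) (hK : K = 32 * Q ^ 2 + 1)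
    (hc : 0 ≤ c)
    (hA : |A| ≤ c) (hB : |B| ≤ c * (1 + w ^ 2)) (hR : |R| ≤ c * (1 + |w|))
    (hz : 0 < z) (hz1 : z ≤ 1) (he : 0 < e) (he1 : e ≤ 1)
    (hP0 : 0 < P0) (hM : P0 ≤ M) (hd : 0 < d)
    (k1 : z ^ 2 * (2 * w1 ^ 2 * (K + q ^ 2) + 2 * w * w2 * (K + q ^ 2) + 10 * w ^ 2 * w1 * q + 2 * w ^ 4)
      ≤ 28 * (w ^ 2 * (K + q ^ 2)))
    (k3 : 0 ≤ (w ^ 2 * (K + q ^ 2)) / d + e * (2 * w * (M * (w2 + A * w1 + B)) * (K + q ^ 2)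
      + 2 * w ^ 2 * q * (M * (w1 + R)))) :
    z ^ 2 * e * (w ^ 2 * (K + q ^ 2)) ≤ (K + Q ^ 2) * (2 * ((1 / (d * P0) + 28) * (K + Q ^ 2)) +
      2 * (81 * ((K + Q ^ 2) * (c ^ 2 + 2 * c) + 2 * Q * c) ^ 4
        + 3 * ((K + Q ^ 2) * (c ^ 2 + 2 * c) + 2 * Q * c)) + 1) := by
  have hS := bern2_S (w1 := w1) hq hK hc hA hB hR
  have hQ : 0 ≤ Q := (abs_nonneg q).trans hq
  have hq2 : q ^ 2 ≤ Q ^ 2 := by rw [← sq_abs]; gcongr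
  have hφ0 : 0 < K + q ^ 2 := by rw [hK]; positivity
  have hM0 : 0 < M := lt_of_lt_of_le hP0 hM
  have hc0 : 0 ≤ 81 * ((K + Q ^ 2) * (c ^ 2 + 2 * c) + 2 * Q * c) ^ 4
        + 3 * ((K + Q ^ 2) * (c ^ 2 + 2 * c) + 2 * Q * c) := by
    have : 0 ≤ K := by rw [hK]; positivity
    positivity
  set C' := 81 * ((K + Q ^ 2) * (c ^ 2 + 2 * c) + 2 * Q * c) ^ 4
        + 3 * ((K + Q ^ 2) * (c ^ 2 + 2 * c) + 2 * Q * c)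
  clear_value C'
  set φ := K + q ^ 2 with hφ
  set Φ := K + Q ^ 2 with hΦ
  have hφΦ : φ ≤ Φ := by linarith
  set S := 2 * w * φ * (A * w1 + B) + 2 * w ^ 2 * q * (w1 + R) - 2 * w1 ^ 2 * φ
      - 10 * w ^ 2 * w1 * q - 2 * w ^ 4 with hSd
  set Wrr := 2 * w1 ^ 2 * φ + 2 * w * w2 * φ + 10 * w ^ 2 * w1 * q + 2 * w ^ 4 with hWrr
  set κ := 1 / (d * P0) with hκ
  have hκ0 : 0 < κ := by positivity
  have k4 : 0 ≤ w ^ 2 * φ * κ + e * (Wrr + S) := by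
    have e1 := div_nonneg k3 hM0.le
    have e2 : (w ^ 2 * φ / d + e * (2 * w * (M * (w2 + A * w1 + B)) * φ
      + 2 * w ^ 2 * q * (M * (w1 + R)))) / M = w ^ 2 * φ * (1 / (d * M)) + e * (Wrr + S) := by
      rw [hWrr, hSd]; field_simp; ring
    rw [e2] at e1
    have e3 : 1 / (d * M) ≤ κ := by rw [hκ]; gcongr
    have : w ^ 2 * φ * (1 / (d * M)) ≤ w ^ 2 * φ * κ := by gcongr
    linarith
  have hz2 : z ^ 2 ≤ 1 := pow_le_one₀ hz.le hz1
  have k5 : z ^ 2 * e * w ^ 4 / 2 ≤ (κ + 28) * Φ * w ^ 2 + C' := by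
    have s0 := mul_nonneg (sq_nonneg z) k4
    have s1 : z ^ 2 * (w ^ 2 * φ * κ) ≤ 1 * (w ^ 2 * Φ * κ) := by gcongr
    have s2 : e * (z ^ 2 * Wrr) ≤ 28 * (w ^ 2 * Φ) := by
      have : e * (z ^ 2 * Wrr) ≤ e * (28 * (w ^ 2 * φ)) := by gcongr
      have : e * (28 * (w ^ 2 * φ)) ≤ 1 * (28 * (w ^ 2 * Φ)) := by gcongr
      linarith
    have s3 : e * (z ^ 2 * S) ≤ e * (z ^ 2 * (- w ^ 4 / 2 + C')) := by gcongr
    have s4 : e * z ^ 2 * C' ≤ 1 * C' := by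
      gcongr; rw [mul_comm]; exact mul_le_one₀ hz2 he.le he1
    linarith
  set Y := z ^ 2 * e * w ^ 2 with hY
  have hY0 : 0 ≤ Y := by positivity
  have hze : z ^ 2 * e ≤ 1 := mul_le_one₀ hz2 he.le he1
  have hze0 : 0 < z ^ 2 * e := by positivity
  set L := (κ + 28) * Φ with hL
  have hL0 : 0 ≤ L := by have : 0 ≤ Φ := by linarith
                         positivity
  have k6 : Y ^ 2 ≤ 2 * L * Y + 2 * C' := by
    have := mul_le_mul_of_nonneg_left k5 hze0.le
    have e4 : z ^ 2 * e * C' ≤ 1 * C' := by gcongr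
    rw [hY]
    linarith
  have k7 : Y ≤ 2 * L + 2 * C' + 1 := by
    by_contra hcon
    push Not at hcon
    have h1 := mul_lt_mul_of_pos_left hcon (by linarith : 0 < Y)
    have h2 : C' * 1 ≤ C' * Y := by gcongr; linarith
    linarith
  calc z ^ 2 * e * (w ^ 2 * φ) = φ * Y := by rw [hY]; ring
    _ ≤ Φ * (2 * L + 2 * C' + 1) := by
      have : 0 ≤ Φ := by linarith
      gcongr
end SDB

namespace SDB
variable {T : ℝ}

lemma abs_le_aux {x C : ℝ} (h : x * x ≤ C) : |x| ≤ C + 1 := by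
  have := abs_mul_abs_self x
  nlinarith [sq_nonneg (|x| - 1)]

lemma abs_le_aux2 (x : ℝ) : |x| ≤ 1 + x ^ 2 := by
  have := sq_abs x
  nlinarith [sq_nonneg (|x| - 1)]

def PLow (T m : ℝ) (h : ℝ × ℝ → ℝ) : Prop := ∀ t1, 0 < t1 → t1 < T → ∃ P0, 0 < P0 ∧
  ∀ r t, 1 ≤ r → t1 ≤ t → t < T → P0 ≤ m * Real.exp ((m - 1) * h (r, t))

lemma box_bdd {f : ℝ × ℝ → ℝ} (hf : Sm T f) {a b t1 t2 : ℝ} (ha : 0 < a) (h1 : 0 < t1)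
    (h2 : t2 < T) : ∃ C, 0 ≤ C ∧ ∀ r t, a ≤ r → r ≤ b → t1 ≤ t → t ≤ t2 → |f (r, t)| ≤ C := by
  obtain ⟨C, hC⟩ := (isCompact_Icc.prod isCompact_Icc).exists_bound_of_continuousOn
    (hf.cont.mono (box_sub (b := b) ha h1 h2))
  refine ⟨|C|, abs_nonneg _, fun r t x1 x2 x3 x4 => ?_⟩
  exact (hC (r, t) ⟨⟨x1, x2⟩, ⟨x3, x4⟩⟩).trans (le_abs_self C)

lemma bdd_of_far {f : ℝ × ℝ → ℝ} (hf : Sm T f)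
    (h : ∀ t1 t2, 0 < t1 → t1 ≤ t2 → t2 < T →
      ∃ C, 0 ≤ C ∧ ∀ r t, 2 ≤ r → t1 ≤ t → t ≤ t2 → |f (r, t)| ≤ C) : Bdd T f := by
  intro t1 t2 h1 h12 h2
  obtain ⟨C1, c1, k1⟩ := h t1 t2 h1 h12 h2
  obtain ⟨C2, c2, k2⟩ := box_bdd (b := 2) hf one_pos h1 h2
  refine ⟨C1 + C2, by positivity, fun r t x y z => ?_⟩
  rcases le_total 2 r with hr | hr
  · linarith [k1 r t hr y z]
  · linarith [k2 r t x hr y z]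

lemma bern1 {m n : ℝ} {h : ℝ × ℝ → ℝ} (hh : Sm T h) (he : LogEq T m n h) (hP : PLow T m h)
    (hm0 : 0 < m) (hm1 : m < 1) (hn : 0 ≤ n) : Bdd T (H h 1) := by
  apply bdd_of_far (Sm_H hh 1)
  intro t1 t2 h1 h12 h2
  obtain ⟨P0, hP0, hPl⟩ := hP (t1 / 2) (by linarith) (by linarith)
  set C := (1 / (t1 / 2 * P0) + 28 + 16 * n) / (m * (1 - m))
      + ((8 + 8 * n) / (2 * (m * (1 - m)))) ^ 2 with hC
  have hC0 : 0 ≤ C := by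
    have : 0 < 1 - m := by linarith
    positivity
  refine ⟨C + 1, by linarith, fun r0 t hr0 ht1 ht2 => ?_⟩
  have s1 := Sm_H hh 1
  have hW := s1.mul s1
  have key := cutoff (W := fun p => H h 1 p * H h 1 p) hW (r0 := r0) (t1 := t - t1 / 2) (t2 := t)
    (C := C) hr0 (by linarith) (by linarith) (by linarith) hC0 ?_
  · exact abs_le_aux key
  · intro r s z e hr hs1 hs2 hz hz1 he0 he1 hWp k1 k2 k3
    have hp : (r, s) ∈ Om T := mem_Om.2 ⟨by linarith, by linarith, by linarith⟩
    have d1 : ∀ p ∈ Om T, Dr (fun p => H h 1 p * H h 1 p) p = 2 * (H h 1 p * H h 2 p) := by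
      intro p hp
      rw [s1.Dr_mul s1 hp, ← H_succ]; ring
    have s2 := Sm_H hh 2
    rw [Dr_congr d1 _ hp, (Sm.const 2).Dr_mul (s1.mul s2) hp, Dr_const, s1.Dr_mul s2 hp, ← H_succ,
      ← H_succ] at k1
    rw [d1 _ hp] at k2
    rw [s1.Dt_mul s1 hp, eq_one hh he _ hp] at k3
    have := bern1_alg (a := H h 1 (r, s)) (b := H h 2 (r, s)) (c3 := H h 3 (r, s)) (ct := ct (r, s))
      (z := z) (e := e) (M := m * Real.exp ((m - 1) * h (r, s))) (P0 := P0) (d := t1 / 2)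
      hm0 hm1 hn (ct_one_le (by linarith)) (ct_le_four (by linarith)) hz hz1 he0 he1 hP0
      (hPl r s (by linarith) (by linarith) (by linarith)) (by linarith) (by rw [pow_two]; exact hWp)
      (by norm_num at k1 ⊢; linarith)
      (by rw [mul_assoc]; linarith)
      (by refine k3.trans (le_of_eq ?_); rw [sub_sub_cancel]; ring)
    rw [← pow_two]
    exact this

lemma bern2_alg' (Q c P0 d : ℝ) (hQ : 0 ≤ Q) (hc : 0 ≤ c) (hP0 : 0 < P0) (hd : 0 < d) :
    ∃ K C : ℝ, 1 ≤ K ∧ 0 ≤ C ∧ ∀ w w1 w2 q A B R z e M : ℝ, |q| ≤ Q → |A| ≤ c →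
      |B| ≤ c * (1 + w ^ 2) → |R| ≤ c * (1 + |w|) → 0 < z → z ≤ 1 → 0 < e → e ≤ 1 → P0 ≤ M →
      (z ^ 2 * (2 * w1 ^ 2 * (K + q ^ 2) + 2 * w * w2 * (K + q ^ 2) + 10 * w ^ 2 * w1 * q + 2 * w ^ 4)
      ≤ 28 * (w ^ 2 * (K + q ^ 2))) →
      (0 ≤ (w ^ 2 * (K + q ^ 2)) / d + e * (2 * w * (M * (w2 + A * w1 + B)) * (K + q ^ 2)
      + 2 * w ^ 2 * q * (M * (w1 + R)))) →
      z ^ 2 * e * (w ^ 2 * (K + q ^ 2)) ≤ C := by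
  refine ⟨32 * Q ^ 2 + 1, _, ?_, ?_, fun w w1 w2 q A B R z e M x1 x2 x3 x4 x5 x6 x7 x8 x9 x10 x11 =>
    bern2_alg x1 rfl hc x2 x3 x4 x5 x6 x7 x8 hP0 x9 hd x10 x11⟩
  · linarith [sq_nonneg Q]
  · positivity

lemma bern2 {m n : ℝ} {h : ℝ × ℝ → ℝ} (hh : Sm T h) (he : LogEq T m n h) (hP : PLow T m h)
    (j : ℕ) (hj : 1 ≤ j) (ih : ∀ i, 1 ≤ i → i ≤ j → Bdd T (H h i)) : Bdd T (H h (j + 1)) := by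
  obtain ⟨α', B', pB', eB', -⟩ := structure_eq hh he j hj
  obtain ⟨α, B, pB, eB, hB⟩ := structure_eq hh he (j + 1) (by omega)
  obtain ⟨b0, b1, b2, q0, q1, q2, eb⟩ := hB (by omega)
  simp only [Nat.add_sub_cancel] at q0 q1 q2
  have qA : ∀ a : ℝ, Pol h j (fun p => a * H h 1 p + n * ct p) := fun a =>
    .add (.mul (.const _ a) (.H _ 1 le_rfl hj)) (.mul (.const _ n) (.ct _))
  apply bdd_of_far (Sm_H hh _)
  intro t1 t2 h1 h12 h2
  have th : 0 < t1 / 2 := by linarith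
  have th2 : t1 / 2 ≤ t2 := by linarith
  obtain ⟨P0, hP0, hPl⟩ := hP (t1 / 2) th (by linarith)
  obtain ⟨Q, hQ, kQ⟩ := ih j hj le_rfl (t1 / 2) t2 th th2 h2
  obtain ⟨c0, hc0, k0⟩ := (q0.bdd ih) (t1 / 2) t2 th th2 h2
  obtain ⟨c1, hc1, k1⟩ := (q1.bdd ih) (t1 / 2) t2 th th2 h2
  obtain ⟨c2, hc2, k2⟩ := (q2.bdd ih) (t1 / 2) t2 th th2 h2
  obtain ⟨c3, hc3, k3⟩ := ((qA α).bdd ih) (t1 / 2) t2 th th2 h2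
  obtain ⟨c4, hc4, k4⟩ := ((qA α').bdd ih) (t1 / 2) t2 th th2 h2
  obtain ⟨c5, hc5, k5⟩ := (pB'.bdd ih) (t1 / 2) t2 th th2 h2
  set c := c0 + 2 * c1 + c2 + c3 + c4 + c5 with hc
  have hcn : 0 ≤ c := by positivity
  obtain ⟨K, C, hK1, hC0, hKC⟩ := bern2_alg' Q c P0 (t1 / 2) hQ hcn hP0 th
  refine ⟨C + 1, by linarith, fun r0 t hr0 ht1 ht2 => ?_⟩
  have sw := Sm_H hh (j + 1)
  have sq := Sm_H hh j
  have sw1 := Sm_H hh (j + 2)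
  have sφ := (Sm.const K).add (sq.mul sq)
  have key := cutoff (W := fun p => (H h (j + 1) p * H h (j + 1) p) * (K + H h j p * H h j p))
    ((sw.mul sw).mul sφ) (r0 := r0) (t1 := t - t1 / 2) (t2 := t)
    (C := C) hr0 (by linarith) (by linarith) (by linarith) hC0 ?_
  · have e2 : H h (j + 1) (r0, t) * H h (j + 1) (r0, t) * 1 ≤ C := by
      refine le_trans ?_ key
      apply mul_le_mul_of_nonneg_left _ (mul_self_nonneg _)
      have := mul_self_nonneg (H h j (r0, t))
      linarith
    rw [mul_one] at e2
    exact abs_le_aux e2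
  · intro r s z e hr hs1 hs2 hz hz1 he0 he1 hWp x1 x2 x3
    have hp : (r, s) ∈ Om T := mem_Om.2 ⟨by linarith, by linarith, by linarith⟩
    have r1 : 1 ≤ r := by linarith
    have g1 : t1 / 2 ≤ s := by linarith
    have g2 : s ≤ t2 := by linarith
    have dφ : ∀ p ∈ Om T, Dr (fun p => K + H h j p * H h j p) p = 2 * (H h j p * H h (j + 1) p) := by
      intro p hp
      rw [(Sm.const K).Dr_add (sq.mul sq) hp, Dr_const, sq.Dr_mul sq hp, ← H_succ]; ring
    have dw : ∀ p ∈ Om T, Dr (fun p => H h (j + 1) p * H h (j + 1) p) p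
        = 2 * (H h (j + 1) p * H h (j + 2) p) := by
      intro p hp
      rw [sw.Dr_mul sw hp, ← H_succ]; ring
    have d1 : ∀ p ∈ Om T, Dr (fun p => (H h (j + 1) p * H h (j + 1) p) * (K + H h j p * H h j p)) p
        = 2 * (H h (j + 1) p * H h (j + 2) p) * (K + H h j p * H h j p)
         + (H h (j + 1) p * H h (j + 1) p) * (2 * (H h j p * H h (j + 1) p)) := by
      intro p hp
      rw [(sw.mul sw).Dr_mul sφ hp, dφ p hp, dw p hp]
    have u1 := (Sm.const 2).mul (sw.mul sw1)
    have u2 := (Sm.const 2).mul (sq.mul sw)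
    rw [Dr_congr d1 _ hp, (u1.mul sφ).Dr_add ((sw.mul sw).mul u2) hp, u1.Dr_mul sφ hp,
      (sw.mul sw).Dr_mul u2 hp, dφ _ hp, dw _ hp, (Sm.const 2).Dr_mul (sw.mul sw1) hp,
      (Sm.const 2).Dr_mul (sq.mul sw) hp, Dr_const, sw.Dr_mul sw1 hp, sq.Dr_mul sw hp,
      ← H_succ, ← H_succ, ← H_succ] at x1
    rw [(sw.mul sw).Dt_mul sφ hp, sw.Dt_mul sw hp, (Sm.const K).Dt_add (sq.mul sq) hp, Dt_const,
      sq.Dt_mul sq hp, eB _ hp, eB' _ hp, sub_sub_cancel] at x3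
    have ew : |H h (j + 1) (r, s)| ≤ 1 + H h (j + 1) (r, s) ^ 2 := abs_le_aux2 _
    have hBb : |B (r, s)| ≤ c * (1 + H h (j + 1) (r, s) ^ 2) := by
      rw [eb _ hp]
      have y0 := k0 r s r1 g1 g2
      have y1 := k1 r s r1 g1 g2
      have y2 := k2 r s r1 g1 g2
      calc |b0 (r, s) + b1 (r, s) * H h (j + 1) (r, s) + b2 (r, s) * H h (j + 1) (r, s) ^ 2|
          ≤ |b0 (r, s)| + |b1 (r, s)| * |H h (j + 1) (r, s)| + |b2 (r, s)| * H h (j + 1) (r, s) ^ 2 := by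
            refine (abs_add_le _ _).trans (add_le_add ((abs_add_le _ _).trans (add_le_add le_rfl ?_)) ?_)
            · rw [abs_mul]
            · rw [abs_mul, abs_of_nonneg (sq_nonneg (H h (j + 1) (r, s)))]
        _ ≤ c0 + c1 * (1 + H h (j + 1) (r, s) ^ 2) + c2 * H h (j + 1) (r, s) ^ 2 := by gcongr
        _ ≤ c * (1 + H h (j + 1) (r, s) ^ 2) := by
          rw [hc]
          have : 0 ≤ (c0 + c1 + c3 + c4 + c5) * H h (j + 1) (r, s) ^ 2 := by positivity
          linarith
    have hRb : |(α' * H h 1 (r, s) + n * ct (r, s)) * H h (j + 1) (r, s) + B' (r, s)|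
        ≤ c * (1 + |H h (j + 1) (r, s)|) := by
      have y4 : |α' * H h 1 (r, s) + n * ct (r, s)| ≤ c4 := k4 r s r1 g1 g2
      have y5 := k5 r s r1 g1 g2
      calc _ ≤ |α' * H h 1 (r, s) + n * ct (r, s)| * |H h (j + 1) (r, s)| + |B' (r, s)| := by
            refine (abs_add_le _ _).trans (add_le_add ?_ le_rfl)
            rw [abs_mul]
        _ ≤ c4 * |H h (j + 1) (r, s)| + c5 := by gcongr
        _ ≤ _ := by
          rw [hc]
          have : 0 ≤ (c0 + 2 * c1 + c2 + c3 + c5) * |H h (j + 1) (r, s)| := by positivity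
          linarith
    have hAb : |α * H h 1 (r, s) + n * ct (r, s)| ≤ c := by
      have y3 : |α * H h 1 (r, s) + n * ct (r, s)| ≤ c3 := k3 r s r1 g1 g2
      rw [hc]; linarith
    have := hKC (H h (j + 1) (r, s)) (H h (j + 2) (r, s)) (H h (j + 3) (r, s))
      (H h j (r, s)) _ _ _ z e (m * Real.exp ((m - 1) * h (r, s)))
      (kQ r s r1 g1 g2) hAb hBb hRb hz hz1 he0 he1
      (hPl r s r1 g1 (by linarith))
      (by refine le_trans (le_of_eq ?_) (x1.trans (le_of_eq ?_)) <;> ring)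
      (by refine x3.trans (le_of_eq ?_); ring)
    refine le_trans (le_of_eq ?_) this
    ring

lemma bern {m n : ℝ} {h : ℝ × ℝ → ℝ} (hh : Sm T h) (he : LogEq T m n h) (hP : PLow T m h)
    (hm0 : 0 < m) (hm1 : m < 1) (hn : 0 ≤ n) (k : ℕ) : ∀ i, 1 ≤ i → i ≤ k → Bdd T (H h i) := by
  induction k with
  | zero => intro i h1 h2; omega
  | succ k ih =>
    intro i h1 h2
    rcases Nat.lt_or_ge i (k + 1) with h3 | h3
    · exact ih i h1 (by omega)
    · have : i = k + 1 := by omega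
      subst this
      rcases Nat.eq_zero_or_pos k with h0 | h0
      · subst h0; exact bern1 hh he hP hm0 hm1 hn
      · exact bern2 hh he hP k h0 ih

end SDB

namespace SDB
variable {T : ℝ}

lemma v_eq {m n : ℝ} {h : ℝ × ℝ → ℝ} (hh : Sm T h) (he : LogEq T m n h) {p : ℝ × ℝ}
    (hp : p ∈ Om T) : Dt (fun p => Real.exp (m * h p)) p = m * Real.exp ((m - 1) * h p) *
      (Dr (Dr (fun p => Real.exp (m * h p))) p + n * ct p * Dr (fun p => Real.exp (m * h p)) p) := by
  have hs : Sm T (fun p => Real.exp (m * h p)) := ((Sm.const m).mul hh).exp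
  have d1 : ∀ p ∈ Om T, Dr (fun p => Real.exp (m * h p)) p = Real.exp (m * h p) * (m * H h 1 p) := by
    intro p hp
    rw [((Sm.const m).mul hh).Dr_exp hp, (Sm.const m).Dr_mul hh hp, Dr_const, H_succ, H_zero]
    ring
  have d2 : Dr (Dr (fun p => Real.exp (m * h p))) p = Real.exp (m * h p) *
      (m * H h 2 p + m ^ 2 * H h 1 p ^ 2) := by
    rw [Dr_congr d1 _ hp, hs.Dr_mul ((Sm.const m).mul (Sm_H hh 1)) hp, d1 _ hp,
      (Sm.const m).Dr_mul (Sm_H hh 1) hp, Dr_const, H_succ h 1]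
    ring
  rw [d2, d1 p hp, ((Sm.const m).mul hh).Dt_exp hp, (Sm.const m).Dt_mul hh hp, Dt_const, he p hp]
  ring

lemma invP_le {m x X : ℝ} (hm0 : 0 < m) (hm1 : m < 1) (hx : Real.exp (m * x) ≤ X) :
    Real.exp ((1 - m) * x) ≤ X ^ (1 / m - 1) := by
  have e : Real.exp ((1 - m) * x) = Real.exp (m * x) ^ (1 / m - 1) := by
    rw [← Real.exp_mul]; congr 1; field_simp
  have hb : 0 ≤ 1 / m - 1 := by
    rw [sub_nonneg, le_div_iff₀ hm0]; linarith
  rw [e]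
  exact Real.rpow_le_rpow (Real.exp_pos _).le hx hb

lemma P_mul {m x : ℝ} : Real.exp ((m - 1) * x) * Real.exp ((1 - m) * x) = 1 := by
  rw [← Real.exp_add, Real.exp_eq_one_iff]; ring

lemma plow_of {m n : ℝ} {h : ℝ × ℝ → ℝ} (hm0 : 0 < m) (hm1 : m < 1) (hn : 0 ≤ n)
    (hap : ∀ t1, 0 < t1 → t1 < T → ∃ V0, 1 ≤ V0 ∧ ∀ r t, 1 ≤ r → t1 ≤ t → t < T →
      Real.exp (m * h (r, t)) ≤ V0 * Real.exp (-(n / 2) * r)) : PLow T m h := by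
  intro t1 h1 hT
  obtain ⟨V0, hV, hb⟩ := hap t1 h1 hT
  have hX : 0 < V0 ^ (1 / m - 1) := Real.rpow_pos_of_pos (by linarith) _
  refine ⟨m / V0 ^ (1 / m - 1), by positivity, fun r t hr ht1 ht2 => ?_⟩
  have h2 : Real.exp (m * h (r, t)) ≤ V0 := by
    refine (hb r t hr ht1 ht2).trans ?_
    have : Real.exp (-(n / 2) * r) ≤ 1 := Real.exp_le_one_iff.2 (by nlinarith)
    nlinarith
  have h3 := invP_le hm0 hm1 h2
  rw [div_le_iff₀ hX]
  have h4 := P_mul (m := m) (x := h (r, t))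
  have h5 := Real.exp_pos ((m - 1) * h (r, t))
  calc m = m * (Real.exp ((m - 1) * h (r, t)) * Real.exp ((1 - m) * h (r, t))) := by rw [h4, mul_one]
    _ ≤ m * (Real.exp ((m - 1) * h (r, t)) * V0 ^ (1 / m - 1)) := by gcongr
    _ = _ := by ring

lemma exists_R0 {c1 c2 δ : ℝ} (h1 : 0 < c1) (h2 : 0 < c2) (hδ : 0 < δ) :
    ∃ R0, 1 ≤ R0 ∧ ∀ r, R0 ≤ r → c2 * r * Real.exp (-δ * r) < c1 := by
  refine ⟨1 + 2 * c2 / (c1 * δ ^ 2), by have : 0 < 2 * c2 / (c1 * δ ^ 2) := by positivity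
                                        linarith, fun r hr => ?_⟩
  have hp : 0 < 2 * c2 / (c1 * δ ^ 2) := by positivity
  have hr0 : 0 < r := by linarith
  have e1 := Real.quadratic_le_exp_of_nonneg (by positivity : 0 ≤ δ * r)
  have e2 : 2 * c2 / (c1 * δ ^ 2) ≤ r := by linarith
  rw [div_le_iff₀ (by positivity)] at e2
  rw [show -δ * r = -(δ * r) by ring, Real.exp_neg, ← div_eq_mul_inv, div_lt_iff₀ (Real.exp_pos _)]
  have e3 := mul_le_mul_of_nonneg_left e1 h1.le
  have e4 := mul_le_mul_of_nonneg_right e2 hr0.le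
  have : 0 < c1 * (δ * r) := by positivity
  nlinarith

/-- derivative facts for the upper barrier -/
lemma barU {a w t1 R0 K : ℝ} {p : ℝ × ℝ} (hp : p ∈ Om T) :
    Sm T (fun p => K * Real.exp (-(a + w * (p.2 - t1)) * (p.1 - R0))) ∧
    Dr (fun p => K * Real.exp (-(a + w * (p.2 - t1)) * (p.1 - R0))) p =
      -(a + w * (p.2 - t1)) * (K * Real.exp (-(a + w * (p.2 - t1)) * (p.1 - R0))) ∧
    Dr (Dr (fun p => K * Real.exp (-(a + w * (p.2 - t1)) * (p.1 - R0)))) p =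
      (a + w * (p.2 - t1)) ^ 2 * (K * Real.exp (-(a + w * (p.2 - t1)) * (p.1 - R0))) ∧
    Dt (fun p => K * Real.exp (-(a + w * (p.2 - t1)) * (p.1 - R0))) p =
      -(w * (p.1 - R0)) * (K * Real.exp (-(a + w * (p.2 - t1)) * (p.1 - R0))) := by
  have sA : Sm T (fun p => -(a + w * (p.2 - t1))) := by
    have := (Sm.const 0 (T := T)).sub ((Sm.const a).add ((Sm.const w).mul (Sm.snd.sub (Sm.const t1))))
    simpa using this
  have sr : Sm T (fun p => p.1 - R0) := Sm.fst.sub (Sm.const R0)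
  have sL := sA.mul sr
  have sE := sL.exp
  have sG : Sm T (fun p => K * Real.exp (-(a + w * (p.2 - t1)) * (p.1 - R0))) := (Sm.const K).mul sE
  have dA : ∀ p ∈ Om T, Dr (fun p => -(a + w * (p.2 - t1))) p = 0 := fun p hp =>
    sA.Dr_eq hp (hasDerivAt_const p.1 (-(a + w * (p.2 - t1))))
  have dr : ∀ p ∈ Om T, Dr (fun p => p.1 - R0) p = 1 := fun p hp =>
    sr.Dr_eq hp ((hasDerivAt_id _).sub_const R0)
  have tA : Dt (fun p => -(a + w * (p.2 - t1))) p = -w := by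
    apply sA.Dt_eq hp
    exact ((((hasDerivAt_id p.2).sub_const t1).const_mul w).const_add a).neg.congr_deriv (by simp)
  have tr : Dt (fun p => p.1 - R0) p = 0 := sr.Dt_eq hp (hasDerivAt_const p.2 (p.1 - R0))
  have d1 : ∀ p ∈ Om T, Dr (fun p => K * Real.exp (-(a + w * (p.2 - t1)) * (p.1 - R0))) p =
      -(a + w * (p.2 - t1)) * (K * Real.exp (-(a + w * (p.2 - t1)) * (p.1 - R0))) := by
    intro p hp
    rw [(Sm.const K).Dr_mul sE hp, Dr_const, sL.Dr_exp hp, sA.Dr_mul sr hp, dA p hp, dr p hp]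
    ring
  refine ⟨sG, d1 p hp, ?_, ?_⟩
  · rw [Dr_congr d1 p hp, sA.Dr_mul sG hp, dA p hp, d1 p hp]; ring
  · rw [(Sm.const K).Dt_mul sE hp, Dt_const, sL.Dt_exp hp, sA.Dt_mul sr hp, tA, tr]
    ring

lemma Sm.Dr_sub {f g : ℝ × ℝ → ℝ} (hf : Sm T f) (hg : Sm T g) {p : ℝ × ℝ} (hp : p ∈ Om T) :
    SDB.Dr (fun p => f p - g p) p = SDB.Dr f p - SDB.Dr g p :=
  (hf.sub hg).Dr_eq hp ((hf.hasR hp).sub (hg.hasR hp))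
lemma Sm.Dt_sub {f g : ℝ × ℝ → ℝ} (hf : Sm T f) (hg : Sm T g) {p : ℝ × ℝ} (hp : p ∈ Om T) :
    SDB.Dt (fun p => f p - g p) p = SDB.Dt f p - SDB.Dt g p :=
  (hf.sub hg).Dt_eq hp ((hf.hasT hp).sub (hg.hasT hp))

lemma sub3 {f g : ℝ × ℝ → ℝ} (hf : Sm T f) (hg : Sm T g) (ε : ℝ) {p : ℝ × ℝ} (hp : p ∈ Om T) :
    Sm T (fun p => f p - g p - ε) ∧
    Dr (fun p => f p - g p - ε) p = Dr f p - Dr g p ∧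
    Dr (Dr (fun p => f p - g p - ε)) p = Dr (Dr f) p - Dr (Dr g) p ∧
    Dt (fun p => f p - g p - ε) p = Dt f p - Dt g p := by
  have d1 : ∀ p ∈ Om T, Dr (fun p => f p - g p - ε) p = Dr f p - Dr g p := fun p hp => by
    rw [(hf.sub hg).Dr_sub (Sm.const ε) hp, hf.Dr_sub hg hp, Dr_const, sub_zero]
  refine ⟨(hf.sub hg).sub (Sm.const ε), d1 p hp, ?_, ?_⟩
  · rw [Dr_congr d1 p hp, hf.Dr.Dr_sub hg.Dr hp]
  · rw [(hf.sub hg).Dt_sub (Sm.const ε) hp, hf.Dt_sub hg hp, Dt_const, sub_zero]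

lemma upper {m n : ℝ} {h : ℝ × ℝ → ℝ} (hh : Sm T h) (he : LogEq T m n h)
    (hm0 : 0 < m) (hm1 : m < 1) (hn : 0 < n) (hγ : 2 < n / 2 * (1 / m - 1))
    (hap : ∀ t1, 0 < t1 → t1 < T → ∃ V0, 1 ≤ V0 ∧ ∀ r t, 1 ≤ r → t1 ≤ t → t < T →
      Real.exp (m * h (r, t)) ≤ V0 * Real.exp (-(n / 2) * r)) {t : ℝ} (ht : 0 < t) (htT : t < T) :
    ∃ C, 0 < C ∧ ∀ r, 1 ≤ r → Real.exp (m * h (r, t)) ≤ C * Real.exp (-n * r) := by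
  obtain ⟨V0, hV, hb⟩ := hap (t / 2) (by linarith) (by linarith)
  set γ := n / 2 * (1 / m - 1) with hγd
  set w := n / t with hw
  have hw0 : 0 < w := by positivity
  have hX : 0 < V0 ^ (1 / m - 1) := Real.rpow_pos_of_pos (by linarith) _
  obtain ⟨R0, hR1, hR0⟩ := exists_R0 (c1 := m * n ^ 2) (c2 := w * V0 ^ (1 / m - 1)) (δ := γ - 2)
    (by positivity) (by positivity) (by linarith)
  set K := 2 * V0 * Real.exp (-(n / 2) * R0) with hK
  have hK0 : 0 < K := by positivity
  have hs : Sm T (fun p => Real.exp (m * h p)) := ((Sm.const m).mul hh).exp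
  have main : ∀ ε > 0, ∀ r, R0 ≤ r →
      Real.exp (m * h (r, t)) ≤ K * Real.exp (-n * (r - R0)) + ε := by
    intro ε hε r hr
    obtain ⟨b, hbr, hbε⟩ : ∃ b, r ≤ b ∧ V0 * Real.exp (-(n / 2) * b) < ε := by
      have h1 : Tendsto (fun b : ℝ => V0 * Real.exp (-(n / 2) * b)) atTop (𝓝 (V0 * 0)) := by
        apply Tendsto.const_mul
        apply Real.tendsto_exp_atBot.comp
        exact tendsto_id.const_mul_atTop_of_neg (by linarith)
      rw [mul_zero] at h1
      obtain ⟨b, h2, h3⟩ := ((h1.eventually (gt_mem_nhds hε)).and (eventually_ge_atTop r)).exists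
      exact ⟨b, h3, h2⟩
    have p0 : (r, t) ∈ Om T := mem_Om.2 ⟨by linarith, ht, htT⟩
    have sG := (barU (a := n / 2) (w := w) (t1 := t / 2) (R0 := R0) (K := K) p0).1
    have := touch (D := fun p => Real.exp (m * h p) -
      K * Real.exp (-(n / 2 + w * (p.2 - t / 2)) * (p.1 - R0)) - ε)
      ((hs.sub sG).sub (Sm.const ε)) (a := R0) (b := b) (t1 := t / 2) (t2 := t) (by linarith)
      (by linarith) htT ?_ ?_ ?_ ?_ r ⟨hr, hbr⟩ t ⟨by linarith, le_rfl⟩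
    · simp only at this
      have e : n / 2 + w * (t - t / 2) = n := by rw [hw]; field_simp; ring
      rw [e] at this
      linarith
    · intro r hr
      have h1 := hb r (t / 2) (by linarith [hr.1]) le_rfl (by linarith)
      have h2 : K * Real.exp (-(n / 2 + w * (t / 2 - t / 2)) * (r - R0)) =
          2 * (V0 * Real.exp (-(n / 2) * r)) := by
        rw [hK, mul_assoc, ← Real.exp_add, mul_assoc]; ring_nf
      have h3 : 0 < V0 * Real.exp (-(n / 2) * r) := by positivity
      simp only [h2]
      linarith
    · intro s hs
      have h1 := hb R0 s hR1 hs.1 (by linarith [hs.2])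
      have h3 : 0 < V0 * Real.exp (-(n / 2) * R0) := by positivity
      simp only [sub_self, mul_zero, Real.exp_zero, mul_one]
      rw [hK]
      linarith
    · intro s hs
      have h1 := hb b s (by linarith) hs.1 (by linarith [hs.2])
      have : 0 < K * Real.exp (-(n / 2 + w * (s - t / 2)) * (b - R0)) := by positivity
      simp only
      linarith
    · intro r s hr1 hr2 hs1 hs2 _ x1 x2 x3
      have hp : (r, s) ∈ Om T := mem_Om.2 ⟨by linarith, by linarith, by linarith⟩
      obtain ⟨-, y1, y2, y3⟩ := sub3 hs sG ε hp
      obtain ⟨-, z1, z2, z3⟩ := barU (a := n / 2) (w := w) (t1 := t / 2) (R0 := R0) (K := K) hp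
      rw [y1, z1] at x1
      rw [y2, z2] at x2
      rw [y3, z3, v_eq hh he hp] at x3
      simp only at x1 x2 x3
      set G := K * Real.exp (-(n / 2 + w * (s - t / 2)) * (r - R0)) with hG
      have hG0 : 0 < G := by positivity
      set a := n / 2 + w * (s - t / 2) with ha
      have ha1 : n / 2 ≤ a := by
        have : 0 ≤ w * (s - t / 2) := mul_nonneg hw0.le (by linarith)
        linarith
      have ha2 : a ≤ n := by
        have : w * (s - t / 2) ≤ w * (t / 2) := by gcongr; linarith
        have e : w * (t / 2) = n / 2 := by rw [hw]; field_simp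
        linarith
      have q1 : Dr (fun p => Real.exp (m * h p)) (r, s) = -a * G := by linarith
      rw [q1] at x3
      have hc := ct_ge (t := s) (by linarith : 0 < r)
      have hb1 := hb r s (by linarith) (by linarith) (by linarith)
      have hi := invP_le hm0 hm1 hb1
      rw [Real.mul_rpow (by linarith) (Real.exp_pos _).le, ← Real.exp_mul] at hi
      have hPi := P_mul (m := m) (x := h (r, s))
      set P := Real.exp ((m - 1) * h (r, s))
      have hP0 : 0 < P := Real.exp_pos _
      set I := Real.exp ((1 - m) * h (r, s))
      have hI0 : 0 < I := Real.exp_pos _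
      set vrr := Dr (Dr (fun p => Real.exp (m * h p))) (r, s)
      set E := Real.exp (-2 * r) with hE
      have hE0 : 0 < E := Real.exp_pos _
      -- main inequality
      have w1 : vrr + n * ct (r, s) * (-a * G) ≤ -(n ^ 2 * E * G) := by
        have f1 : a - n * ct (r, s) ≤ -(2 * n * E) := by
          have := mul_le_mul_of_nonneg_left hc hn.le
          linarith
        have f2 : a * (a - n * ct (r, s)) ≤ n / 2 * -(2 * n * E) := by
          have : 0 < 2 * n * E := by positivity
          have f3 := mul_le_mul_of_nonneg_left f1 (by linarith : 0 ≤ a)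
          have f4 := mul_le_mul_of_nonneg_right ha1 this.le
          linarith
        have f5 := mul_le_mul_of_nonneg_right f2 hG0.le
        linarith
      have w2 : m * P * (n ^ 2 * E * G) ≤ w * (r - R0) * G := by
        have := mul_le_mul_of_nonneg_left w1 (by positivity : 0 ≤ m * P)
        linarith
      have w3 : m * P * (n ^ 2 * E) ≤ w * r := by
        have : m * P * (n ^ 2 * E) * G ≤ w * (r - R0) * G := by linarith
        have := le_of_mul_le_mul_right this hG0
        have : 0 ≤ w * R0 := by positivity
        linarith
      have w4 : m * n ^ 2 * E ≤ w * r * I := by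
        have := mul_le_mul_of_nonneg_right w3 hI0.le
        calc m * n ^ 2 * E = m * (P * I) * (n ^ 2 * E) := by rw [hPi]; ring
          _ = m * P * (n ^ 2 * E) * I := by ring
          _ ≤ _ := this
      have hr0 : 0 < r := by linarith
      have w5 : m * n ^ 2 * E ≤ w * r * (V0 ^ (1 / m - 1) * Real.exp (-(n / 2) * r * (1 / m - 1))) :=
        w4.trans (by gcongr)
      have w6 : Real.exp (-(n / 2) * r * (1 / m - 1)) = Real.exp (-(γ - 2) * r) * E := by
        rw [hE, ← Real.exp_add, hγd]; ring_nf
      rw [w6] at w5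
      have w7 : m * n ^ 2 * E ≤ (w * V0 ^ (1 / m - 1) * r * Real.exp (-(γ - 2) * r)) * E := by
        linarith
      have w8 := le_of_mul_le_mul_right w7 hE0
      linarith [hR0 r hr1.le]
  refine ⟨K * Real.exp (n * R0) + V0 * Real.exp (n * R0), by positivity, fun r hr => ?_⟩
  rcases le_total R0 r with h1 | h1
  · have : Real.exp (m * h (r, t)) ≤ K * Real.exp (-n * (r - R0)) :=
      le_of_forall_pos_le_add (fun ε hε => main ε hε r h1)
    rw [show -n * (r - R0) = n * R0 + -n * r by ring, Real.exp_add] at this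
    have : 0 < V0 * Real.exp (n * R0) * Real.exp (-n * r) := by positivity
    linarith
  · have h2 := hb r t hr (by linarith) htT
    have h3 : Real.exp (-(n / 2) * r) ≤ Real.exp (n * R0) * Real.exp (-n * r) := by
      rw [← Real.exp_add, Real.exp_le_exp]; nlinarith
    have h4 : V0 * Real.exp (-(n / 2) * r) ≤ V0 * (Real.exp (n * R0) * Real.exp (-n * r)) := by gcongr
    have : 0 < K * Real.exp (n * R0) * Real.exp (-n * r) := by positivity
    linarith
end SDB

namespace SDB
variable {T : ℝ}

lemma expfst (a : ℝ) : Sm T (fun p => Real.exp (-a * p.1)) ∧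
    (∀ p ∈ Om T, Dr (fun p => Real.exp (-a * p.1)) p = -a * Real.exp (-a * p.1)) ∧
    (∀ p ∈ Om T, Dt (fun p => Real.exp (-a * p.1)) p = 0) := by
  have sL : Sm T (fun p => -a * p.1) := (Sm.const (-a)).mul Sm.fst
  have sE := sL.exp
  refine ⟨sE, fun p hp => ?_, fun p hp => ?_⟩
  · rw [sL.Dr_exp hp]
    have : Dr (fun p => -a * p.1) p = -a :=
      sL.Dr_eq hp (((hasDerivAt_id p.1).const_mul (-a)).congr_deriv (by simp))
    rw [this]; ring
  · exact sE.Dt_eq hp (hasDerivAt_const p.2 (Real.exp (-a * p.1)))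

/-- derivative facts for the lower barrier -/
lemma barL {n A0 t1 τ : ℝ} (σ : ℕ) {p : ℝ × ℝ} (hp : p ∈ Om T) :
    Sm T (fun p => A0 * ((p.2 - t1) / τ) ^ (σ + 1) *
      (Real.exp (-n * p.1) + Real.exp (-(n + 1) * p.1))) ∧
    Dr (fun p => A0 * ((p.2 - t1) / τ) ^ (σ + 1) *
      (Real.exp (-n * p.1) + Real.exp (-(n + 1) * p.1))) p = A0 * ((p.2 - t1) / τ) ^ (σ + 1) *
      (-n * Real.exp (-n * p.1) + -(n + 1) * Real.exp (-(n + 1) * p.1)) ∧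
    Dr (Dr (fun p => A0 * ((p.2 - t1) / τ) ^ (σ + 1) *
      (Real.exp (-n * p.1) + Real.exp (-(n + 1) * p.1)))) p = A0 * ((p.2 - t1) / τ) ^ (σ + 1) *
      (n ^ 2 * Real.exp (-n * p.1) + (n + 1) ^ 2 * Real.exp (-(n + 1) * p.1)) ∧
    Dt (fun p => A0 * ((p.2 - t1) / τ) ^ (σ + 1) *
      (Real.exp (-n * p.1) + Real.exp (-(n + 1) * p.1))) p =
      A0 * ((σ + 1) * ((p.2 - t1) / τ) ^ σ / τ) *
      (Real.exp (-n * p.1) + Real.exp (-(n + 1) * p.1)) := by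
  obtain ⟨s1, a1, b1⟩ := expfst (T := T) n
  obtain ⟨s2, a2, b2⟩ := expfst (T := T) (n + 1)
  have sA : Sm T (fun p => A0 * ((p.2 - t1) / τ) ^ (σ + 1)) := by
    have := (Sm.const A0).mul (((Sm.snd.sub (Sm.const t1)).mul (Sm.const (T := T) τ⁻¹)).pow (σ + 1))
    exact this
  have dA : ∀ p ∈ Om T, Dr (fun p => A0 * ((p.2 - t1) / τ) ^ (σ + 1)) p = 0 := fun p hp =>
    sA.Dr_eq hp (hasDerivAt_const p.1 (A0 * ((p.2 - t1) / τ) ^ (σ + 1)))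
  have tA : Dt (fun p => A0 * ((p.2 - t1) / τ) ^ (σ + 1)) p = A0 * ((σ + 1) * ((p.2 - t1) / τ) ^ σ / τ) := by
    apply sA.Dt_eq hp
    refine (((((hasDerivAt_id p.2).sub_const t1).div_const τ).pow (σ + 1)).const_mul A0).congr_deriv ?_
    simp
    left
    ring
  have d1 : ∀ p ∈ Om T, Dr (fun p => A0 * ((p.2 - t1) / τ) ^ (σ + 1) *
      (Real.exp (-n * p.1) + Real.exp (-(n + 1) * p.1))) p = A0 * ((p.2 - t1) / τ) ^ (σ + 1) *
      (-n * Real.exp (-n * p.1) + -(n + 1) * Real.exp (-(n + 1) * p.1)) := by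
    intro p hp
    rw [sA.Dr_mul (s1.add s2) hp, dA p hp, s1.Dr_add s2 hp, a1 p hp, a2 p hp]; ring
  have s3 := (Sm.const (-n)).mul s1
  have s4 := (Sm.const (-(n + 1))).mul s2
  refine ⟨sA.mul (s1.add s2), d1 p hp, ?_, ?_⟩
  · rw [Dr_congr d1 p hp, sA.Dr_mul (s3.add s4) hp, dA p hp, s3.Dr_add s4 hp,
      (Sm.const _).Dr_mul s1 hp, (Sm.const _).Dr_mul s2 hp, a1 p hp, a2 p hp, Dr_const, Dr_const]
    ring
  · rw [sA.Dt_mul (s1.add s2) hp, tA, s1.Dt_add s2 hp, b1 p hp, b2 p hp]; ring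

lemma lower {m n : ℝ} {h : ℝ × ℝ → ℝ} (hh : Sm T h) (he : LogEq T m n h)
    (hm0 : 0 < m) (hm1 : m < 1) (hn : 0 < n) (hβ : 1 ≤ n * (1 / m - 1)) {t : ℝ} (ht : 0 < t)
    (htT : t < T) :
    ∃ C, 0 < C ∧ ∀ r, 1 ≤ r → C * Real.exp (-n * r) ≤ Real.exp (m * h (r, t)) := by
  set β := 1 / m - 1 with hβd
  have hβ0 : 0 < β := by
    by_contra hc
    push Not at hc
    nlinarith
  obtain ⟨R1, hR1⟩ : ∃ R1, R1 = 12 * n + 1 := ⟨_, rfl⟩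
  obtain ⟨Ch, hCh0, hCh⟩ := box_bdd (a := 1) (b := R1) hh one_pos (by linarith : 0 < t / 2) htT
  set c0 := Real.exp (-(m * Ch)) with hc0
  have hc0p : 0 < c0 := Real.exp_pos _
  have hvc : ∀ r s, 1 ≤ r → r ≤ R1 → t / 2 ≤ s → s ≤ t → c0 ≤ Real.exp (m * h (r, s)) := by
    intro r s x1 x2 x3 x4
    rw [hc0, Real.exp_le_exp]
    have := mul_le_mul_of_nonneg_left (abs_le.1 (hCh r s x1 x2 x3 x4)).1 hm0.le
    linarith
  obtain ⟨σ, hσ⟩ := exists_nat_ge (1 / β)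
  have hσ1 : 1 ≤ ((σ + 1 : ℕ) : ℝ) * β := by
    rw [div_le_iff₀ hβ0] at hσ
    push_cast
    linarith
  set τ := t / 2 with hτ
  have hτ0 : 0 < τ := by positivity
  set Z := m * τ * (n + 1) / (8 * (σ + 1)) with hZ
  have hZ0 : 0 < Z := by positivity
  obtain ⟨y, hy0, hy1, hy2⟩ : ∃ y, 0 < y ∧ y ≤ c0 / 2 ∧ y ^ β ≤ Z := by
    refine ⟨min (c0 / 2) (Z ^ (1 / β)), lt_min (by positivity) (Real.rpow_pos_of_pos hZ0 _),
      min_le_left _ _, ?_⟩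
    calc (min (c0 / 2) (Z ^ (1 / β))) ^ β ≤ (Z ^ (1 / β)) ^ β := by
          apply Real.rpow_le_rpow _ (min_le_right _ _) hβ0.le
          exact le_min (by positivity) (Real.rpow_nonneg hZ0.le _)
      _ = Z := by rw [← Real.rpow_mul hZ0.le]; field_simp; simp
  set A0 := y / 2 with hA0
  have hA0p : 0 < A0 := by positivity
  have hs : Sm T (fun p => Real.exp (m * h p)) := ((Sm.const m).mul hh).exp
  have hφ2 : ∀ r : ℝ, 0 < r → Real.exp (-(n + 1) * r) ≤ Real.exp (-n * r) := fun r hr => by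
    rw [Real.exp_le_exp]; linarith
  have hth : ∀ s, τ ≤ s → s ≤ t → 0 ≤ (s - τ) / τ ∧ (s - τ) / τ ≤ 1 := fun s h1 h2 =>
    ⟨div_nonneg (by linarith) hτ0.le, by rw [div_le_one hτ0]; linarith⟩
  have main : ∀ ε > 0, ∀ r, R1 ≤ r →
      A0 * (Real.exp (-n * r) + Real.exp (-(n + 1) * r)) ≤ Real.exp (m * h (r, t)) + ε := by
    intro ε hε r hr
    obtain ⟨b, hbr, hbε⟩ : ∃ b, r ≤ b ∧ A0 * 2 * Real.exp (-n * b) < ε := by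
      have h1 : Tendsto (fun b : ℝ => A0 * 2 * Real.exp (-n * b)) atTop (𝓝 (A0 * 2 * 0)) := by
        apply Tendsto.const_mul
        apply Real.tendsto_exp_atBot.comp
        exact tendsto_id.const_mul_atTop_of_neg (by linarith)
      rw [mul_zero] at h1
      obtain ⟨b, h2, h3⟩ := ((h1.eventually (gt_mem_nhds hε)).and (eventually_ge_atTop r)).exists
      exact ⟨b, h3, h2⟩
    have p0 : (r, t) ∈ Om T := mem_Om.2 ⟨by linarith, ht, htT⟩
    have sG := (barL (n := n) (A0 := A0) (t1 := τ) (τ := τ) σ p0).1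
    have hup : ∀ ρ s, 0 < ρ → τ ≤ s → s ≤ t → A0 * ((s - τ) / τ) ^ (σ + 1) *
      (Real.exp (-n * ρ) + Real.exp (-(n + 1) * ρ)) ≤ A0 * 2 * Real.exp (-n * ρ) := by
      intro ρ s h1 h2 h3
      have e1 := pow_le_one₀ (n := σ + 1) (hth s h2 h3).1 (hth s h2 h3).2
      have e2 := hφ2 ρ h1
      have e4 := (hth s h2 h3).1
      calc _ ≤ A0 * 1 * (Real.exp (-n * ρ) + Real.exp (-n * ρ)) := by gcongr
        _ = _ := by ring
    have := touch (D := fun p => A0 * ((p.2 - τ) / τ) ^ (σ + 1) *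
      (Real.exp (-n * p.1) + Real.exp (-(n + 1) * p.1)) - Real.exp (m * h p) - ε)
      ((sG.sub hs).sub (Sm.const ε)) (a := R1) (b := b) (t1 := τ) (t2 := t) (by linarith)
      hτ0 htT ?_ ?_ ?_ ?_ r ⟨hr, hbr⟩ t ⟨by linarith, le_rfl⟩
    · simp only at this
      have e : (t - τ) / τ = 1 := by rw [div_eq_one_iff_eq hτ0.ne']; linarith
      rw [e] at this
      simp only [one_pow, mul_one] at this
      linarith
    · intro r hr
      have := Real.exp_pos (m * h (r, τ))
      simp only [sub_self, zero_div, ne_eq, Nat.add_eq_zero_iff, one_ne_zero, and_false,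
        not_false_eq_true, zero_pow, mul_zero, zero_mul]
      linarith
    · intro s hs
      have h1 := hvc R1 s (by linarith) le_rfl hs.1 hs.2
      have h2 := hup R1 s (by linarith) hs.1 hs.2
      have h3 : Real.exp (-n * R1) ≤ 1 := Real.exp_le_one_iff.2 (by
        have : 0 ≤ n * R1 := mul_nonneg hn.le (by linarith)
        linarith)
      have h4 : A0 * 2 * Real.exp (-n * R1) ≤ A0 * 2 * 1 := by gcongr
      simp only
      linarith
    · intro s hs
      have h2 := hup b s (by linarith) hs.1 hs.2
      have := Real.exp_pos (m * h (b, s))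
      simp only
      linarith
    · intro r s hr1 hr2 hs1 hs2 x0 x1 x2 x3
      have hr0 : 0 < r := by linarith
      have hp : (r, s) ∈ Om T := mem_Om.2 ⟨hr0, by linarith, by linarith⟩
      obtain ⟨-, y1, y2, y3⟩ := sub3 sG hs ε hp
      obtain ⟨-, z1, z2, z3⟩ := barL (n := n) (A0 := A0) (t1 := τ) (τ := τ) σ hp
      rw [y1, z1] at x1
      rw [y2, z2] at x2
      rw [y3, z3, v_eq hh he hp] at x3
      simp only at x0 x1 x2 x3
      have hth0 : 0 < (s - τ) / τ := div_pos (by linarith) hτ0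
      have hth1 := (hth s hs1.le hs2).2
      set θ := (s - τ) / τ with hθ
      have hcl := ct_le (t := s) (by linarith : 1 ≤ r)
      have hc1 := ct_one_le (t := s) hr0
      have hvle : Real.exp (m * h (r, s)) ≤ A0 * θ ^ (σ + 1) * (2 * Real.exp (-n * r)) := by
        have := hφ2 r hr0
        have e5 : A0 * θ ^ (σ + 1) * (Real.exp (-n * r) + Real.exp (-(n + 1) * r)) ≤
          A0 * θ ^ (σ + 1) * (2 * Real.exp (-n * r)) := by gcongr; linarith
        linarith
      have hi := invP_le hm0 hm1 hvle
      have hPi := P_mul (m := m) (x := h (r, s))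
      have ex1 : Real.exp (-(n + 1) * r) = Real.exp (-n * r) * Real.exp (-r) := by
        rw [← Real.exp_add]; ring_nf
      have ex2 : Real.exp (-2 * r) = Real.exp (-r) * Real.exp (-r) := by
        rw [← Real.exp_add]; ring_nf
      -- bound on the inverse pressure
      have hi2 : (A0 * θ ^ (σ + 1) * (2 * Real.exp (-n * r))) ^ (1 / m - 1) ≤ Z * θ * Real.exp (-r) := by
        have f1 : A0 * θ ^ (σ + 1) * (2 * Real.exp (-n * r)) = y * θ ^ (σ + 1) * Real.exp (-n * r) := by
          rw [hA0]; ring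
        rw [f1, ← hβd, Real.mul_rpow (by positivity) (by positivity),
          Real.mul_rpow (by positivity) (by positivity), ← Real.exp_mul, ← Real.rpow_natCast,
          ← Real.rpow_mul hth0.le]
        have f2 : θ ^ (((σ + 1 : ℕ) : ℝ) * β) ≤ θ ^ (1:ℝ) :=
          Real.rpow_le_rpow_of_exponent_ge hth0 hth1 hσ1
        rw [Real.rpow_one] at f2
        have f3 : Real.exp (-n * r * β) ≤ Real.exp (-r) := by
          rw [Real.exp_le_exp]
          have := mul_le_mul_of_nonneg_right hβ hr0.le
          linarith
        gcongr
      have hi3 := hi.trans hi2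
      set P := Real.exp ((m - 1) * h (r, s))
      have hP0 : 0 < P := Real.exp_pos _
      set I := Real.exp ((1 - m) * h (r, s))
      have hI0 : 0 < I := Real.exp_pos _
      set vrr := Dr (Dr (fun p => Real.exp (m * h p))) (r, s)
      set vr := Dr (fun p => Real.exp (m * h p)) (r, s)
      rw [ex1] at x1 x2 x3
      rw [ex2] at hcl
      set E := Real.exp (-n * r)
      have hE0 : 0 < E := Real.exp_pos _
      set e := Real.exp (-r) with hee
      have he0 : 0 < e := Real.exp_pos _
      have he12 : 12 * n * e ≤ 1 := by
        have : 12 * n ≤ Real.exp r := by linarith [Real.add_one_le_exp r]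
        have e5 : Real.exp r * e = 1 := by rw [hee, ← Real.exp_add]; simp
        calc 12 * n * e ≤ Real.exp r * e := by gcongr
          _ = 1 := e5
      have he1 : e ≤ 1 := Real.exp_le_one_iff.2 (by linarith)
      clear_value θ P I vrr vr E e
      have x1' : vr = A0 * θ ^ (σ + 1) * (-n * E + -(n + 1) * (E * e)) := by linarith
      set A := A0 * θ ^ (σ + 1) with hA
      have hAp : 0 < A := by positivity
      have hcc : n * ct (r, s) * (n * E + (n + 1) * (E * e)) ≤
          n * (1 + 3 * (e * e)) * (n * E + (n + 1) * (E * e)) := by gcongr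
      have lap : (n + 1) / 2 * (E * e) ≤ n ^ 2 * E + (n + 1) ^ 2 * (E * e)
          - n * ct (r, s) * (n * E + (n + 1) * (E * e)) := by
        have g1 : 3 * n * (e * e) * (n + (n + 1) * e) ≤ (n + 1) / 2 * e := by
          have g2 : n + (n + 1) * e ≤ 2 * (n + 1) := by
            have : (n + 1) * e ≤ (n + 1) * 1 := by gcongr
            linarith
          calc 3 * n * (e * e) * (n + (n + 1) * e) ≤ 3 * n * (e * e) * (2 * (n + 1)) := by gcongr
            _ = (12 * n * e) * ((n + 1) / 2 * e) := by ring
            _ ≤ 1 * ((n + 1) / 2 * e) := by gcongr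
            _ = _ := one_mul _
        have g3 := mul_le_mul_of_nonneg_left g1 hE0.le
        linarith
      have w1 : A * ((n + 1) / 2 * (E * e)) ≤ vrr + n * ct (r, s) * vr := by
        have := mul_le_mul_of_nonneg_left lap hAp.le
        rw [x1']
        linarith
      have w2 : m * P * (A * ((n + 1) / 2 * (E * e))) ≤
          A0 * ((σ + 1) * θ ^ σ / τ) * (2 * E) := by
        have g1 := mul_le_mul_of_nonneg_left w1 (by positivity : 0 ≤ m * P)
        have g2 : A0 * ((σ + 1) * θ ^ σ / τ) * (E + E * e) ≤ A0 * ((σ + 1) * θ ^ σ / τ) * (2 * E) := by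
          gcongr
          have : E * e ≤ E * 1 := by gcongr
          linarith
        linarith
      have w3 : m * (A * ((n + 1) / 2 * (E * e))) ≤
          A0 * ((σ + 1) * θ ^ σ / τ) * (2 * E) * (Z * θ * e) := by
        calc m * (A * ((n + 1) / 2 * (E * e))) = m * (P * I) * (A * ((n + 1) / 2 * (E * e))) := by
              rw [hPi]; ring
          _ = m * P * (A * ((n + 1) / 2 * (E * e))) * I := by ring
          _ ≤ A0 * ((σ + 1) * θ ^ σ / τ) * (2 * E) * I := by gcongr
          _ ≤ _ := by gcongr
      have w4 : A0 * ((σ + 1) * θ ^ σ / τ) * (2 * E) * (Z * θ * e) = m * (A * ((n + 1) / 4 * (E * e))) := by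
        rw [hA, hZ, pow_succ]; field_simp; ring
      rw [w4] at w3
      have w5 : 0 < m * (A * ((n + 1) / 4 * (E * e))) := by positivity
      linarith
  refine ⟨min A0 c0, lt_min hA0p hc0p, fun r hr => ?_⟩
  rcases le_total R1 r with h1 | h1
  · have h2 : A0 * (Real.exp (-n * r) + Real.exp (-(n + 1) * r)) ≤ Real.exp (m * h (r, t)) :=
      le_of_forall_pos_le_add (fun ε hε => main ε hε r h1)
    have h3 : min A0 c0 * Real.exp (-n * r) ≤ A0 * Real.exp (-n * r) := by
      gcongr; exact min_le_left _ _
    have : 0 < A0 * Real.exp (-(n + 1) * r) := by positivity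
    linarith
  · have h2 := hvc r t hr h1 (by linarith) le_rfl
    have h3 : min A0 c0 * Real.exp (-n * r) ≤ c0 * 1 := by
      apply mul_le_mul (min_le_right _ _) _ (Real.exp_pos _).le hc0p.le
      rw [Real.exp_le_one_iff]
      have : 0 < n * r := by positivity
      linarith
    linarith
end SDB

namespace SDB
variable {T : ℝ}

lemma pol_r {h : ℝ × ℝ → ℝ} (hh : Sm T h) {u : ℝ → ℝ → ℝ}
    (hU : ∀ r t, (r, t) ∈ Om T → u r t = Real.exp (h (r, t))) (k : ℕ) :
    ∃ f, Pol h k f ∧ ∀ r t, (r, t) ∈ Om T →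
      iteratedDeriv k (fun ρ => u ρ t) r = Real.exp (h (r, t)) * f (r, t) := by
  induction k with
  | zero => exact ⟨_, .const 0 1, fun r t hp => by simp [hU r t hp]⟩
  | succ k ih =>
    obtain ⟨f, hf, hfe⟩ := ih
    obtain ⟨e0, e1, h0, h1, hd⟩ := hf.dr hh
    refine ⟨_, ((Pol.H (k + 1) 1 le_rfl (by omega)).mul (hf.mono (Nat.le_succ k))).add
      ((h0.mono (Nat.le_succ k)).add ((h1.mono (Nat.le_succ k)).mul
        (.H (k + 1) (k + 1) (by omega) le_rfl))), fun r t hp => ?_⟩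
    rw [iteratedDeriv_succ]
    have sf := hf.sm hh
    have e : iteratedDeriv k (fun ρ => u ρ t) =ᶠ[𝓝 r] fun ρ => Real.exp (h (ρ, t)) * f (ρ, t) := by
      filter_upwards [lt_mem_nhds (mem_Om.1 hp).1] with ρ hρ
      exact hfe ρ t (mem_Om.2 ⟨hρ, (mem_Om.1 hp).2⟩)
    rw [e.deriv_eq]
    have := ((hh.exp.mul sf).hasR hp).deriv
    rw [this, hh.exp.Dr_mul sf hp, hh.Dr_exp hp, hd _ hp, H_succ h 0, H_zero]
    ring

lemma pol_t {m n : ℝ} {h : ℝ × ℝ → ℝ} (hh : Sm T h) (he : LogEq T m n h) {u : ℝ → ℝ → ℝ}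
    (hU : ∀ r t, (r, t) ∈ Om T → u r t = Real.exp (h (r, t))) (k : ℕ) :
    ∃ l g, Pol h l g ∧ ∀ r t, (r, t) ∈ Om T →
      iteratedDeriv k (fun τ => u r τ) t =
        Real.exp (h (r, t) + k * ((m - 1) * h (r, t))) * g (r, t) := by
  induction k with
  | zero => exact ⟨0, _, .const 0 1, fun r t hp => by simp [hU r t hp]⟩
  | succ k ih =>
    obtain ⟨l, g, hg, hge⟩ := ih
    obtain ⟨g', hg', hd⟩ := hg.dt hh he
    have hle : l ≤ l + 2 := by omega
    refine ⟨l + 2, _, ((Pol.const (l + 2) ((1 + k * (m - 1)) * m)).mul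
      (((Pol.H (l + 2) 2 (by omega) (by omega)).add
        ((((Pol.const _ m).mul (.H _ 1 le_rfl (by omega))).add ((Pol.const _ n).mul (.ct _))).mul
          (.H _ 1 le_rfl (by omega)))).mul (hg.mono hle))).add hg', fun r t hp => ?_⟩
    rw [iteratedDeriv_succ]
    have sg := hg.sm hh
    have sl : Sm T (fun p => h p + k * ((m - 1) * h p)) :=
      hh.add ((Sm.const _).mul ((Sm.const _).mul hh))
    have e : iteratedDeriv k (fun τ => u r τ) =ᶠ[𝓝 t]
        fun τ => Real.exp (h (r, τ) + k * ((m - 1) * h (r, τ))) * g (r, τ) := by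
      have hp' := mem_Om.1 hp
      filter_upwards [Ioo_mem_nhds hp'.2.1 hp'.2.2] with τ hτ
      exact hge r τ (mem_Om.2 ⟨hp'.1, hτ⟩)
    rw [e.deriv_eq]
    have := ((sl.exp.mul sg).hasT hp).deriv
    have dl : Dt (fun p => h p + k * ((m - 1) * h p)) (r, t) =
        Dt h (r, t) + k * ((m - 1) * Dt h (r, t)) :=
      sl.Dt_eq hp ((hh.hasT hp).add (((hh.hasT hp).const_mul (m - 1)).const_mul (k : ℝ)))
    rw [this, sl.exp.Dt_mul sg hp, sl.Dt_exp hp, hd _ hp, dl, he _ hp]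
    have ex : Real.exp (h (r, t) + ((k + 1 : ℕ) : ℝ) * ((m - 1) * h (r, t))) =
        Real.exp (h (r, t) + k * ((m - 1) * h (r, t))) * Real.exp ((m - 1) * h (r, t)) := by
      rw [← Real.exp_add]; push_cast; ring_nf
    rw [ex]
    ring

/-- boundedness near the origin: iterated partial derivatives extend continuously -/
lemma ext_deriv {f : ℝ × ℝ → ℝ} (hf : ContDiffOn ℝ (⊤ : ℕ∞) f (Ici 0 ×ˢ Ioo 0 T)) (v : ℝ × ℝ)
    (k : ℕ) :
    ContDiffOn ℝ (⊤ : ℕ∞)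
      ((fun g : ℝ × ℝ → ℝ => fun p => fderivWithin ℝ g (Ici 0 ×ˢ Ioo 0 T) p v)^[k] f)
      (Ici 0 ×ˢ Ioo 0 T) := by
  have hS : UniqueDiffOn ℝ ((Ici (0:ℝ)) ×ˢ Ioo 0 T) := (uniqueDiffOn_Ici 0).prod (uniqueDiffOn_Ioo 0 T)
  induction k with
  | zero => exact hf
  | succ k ih =>
    rw [Function.iterate_succ_apply']
    exact (ih.fderivWithin hS (by simp)).clm_apply contDiffOn_const

lemma ext_r {f : ℝ × ℝ → ℝ} (hf : ContDiffOn ℝ (⊤ : ℕ∞) f (Ici 0 ×ˢ Ioo 0 T)) (k : ℕ) :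
    ∀ r t, 0 < r → t ∈ Ioo 0 T → iteratedDeriv k (fun ρ => f (ρ, t)) r =
      ((fun g : ℝ × ℝ → ℝ => fun p => fderivWithin ℝ g (Ici 0 ×ˢ Ioo 0 T) p (1, 0))^[k] f) (r, t) := by
  induction k with
  | zero => intro r t _ _; simp
  | succ k ih =>
    intro r t hr ht
    rw [iteratedDeriv_succ, Function.iterate_succ_apply']
    have e : iteratedDeriv k (fun ρ => f (ρ, t)) =ᶠ[𝓝 r] fun ρ =>
      ((fun g : ℝ × ℝ → ℝ => fun p => fderivWithin ℝ g (Ici 0 ×ˢ Ioo 0 T) p (1, 0))^[k] f) (ρ, t) := by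
      filter_upwards [lt_mem_nhds hr] with ρ hρ using ih ρ t hρ ht
    rw [e.deriv_eq]
    have hd := ((ext_deriv hf (1, 0) k).differentiableOn (by simp) (r, t) ⟨hr.le, ht⟩).hasFDerivWithinAt
    have h2 : HasDerivWithinAt (fun ρ : ℝ => (ρ, t)) ((1 : ℝ), (0 : ℝ)) (Ici 0) r :=
      ((hasDerivAt_id r).prodMk (hasDerivAt_const r t)).hasDerivWithinAt
    have hm : MapsTo (fun ρ : ℝ => (ρ, t)) (Ici 0) (Ici (0:ℝ) ×ˢ Ioo 0 T) := fun ρ hρ => ⟨hρ, ht⟩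
    have h3 := hd.comp_hasDerivWithinAt r h2 hm
    exact (h3.hasDerivAt (Ici_mem_nhds hr)).deriv

lemma ext_t {f : ℝ × ℝ → ℝ} (hf : ContDiffOn ℝ (⊤ : ℕ∞) f (Ici 0 ×ˢ Ioo 0 T)) (k : ℕ) :
    ∀ r t, 0 ≤ r → t ∈ Ioo 0 T → iteratedDeriv k (fun τ => f (r, τ)) t =
      ((fun g : ℝ × ℝ → ℝ => fun p => fderivWithin ℝ g (Ici 0 ×ˢ Ioo 0 T) p (0, 1))^[k] f) (r, t) := by
  induction k with
  | zero => intro r t _ _; simp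
  | succ k ih =>
    intro r t hr ht
    rw [iteratedDeriv_succ, Function.iterate_succ_apply']
    have e : iteratedDeriv k (fun τ => f (r, τ)) =ᶠ[𝓝 t] fun τ =>
      ((fun g : ℝ × ℝ → ℝ => fun p => fderivWithin ℝ g (Ici 0 ×ˢ Ioo 0 T) p (0, 1))^[k] f) (r, τ) := by
      filter_upwards [Ioo_mem_nhds ht.1 ht.2] with τ hτ using ih r τ hr hτ
    rw [e.deriv_eq]
    have hd := ((ext_deriv hf (0, 1) k).differentiableOn (by simp) (r, t) ⟨hr, ht⟩).hasFDerivWithinAt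
    have h2 : HasDerivWithinAt (fun τ : ℝ => (r, τ)) ((0 : ℝ), (1 : ℝ)) (Ioo 0 T) t :=
      ((hasDerivAt_const t r).prodMk (hasDerivAt_id t)).hasDerivWithinAt
    have hm : MapsTo (fun τ : ℝ => (r, τ)) (Ioo 0 T) (Ici (0:ℝ) ×ˢ Ioo 0 T) := fun τ hτ => ⟨hr, hτ⟩
    have h3 := hd.comp_hasDerivWithinAt t h2 hm
    exact (h3.hasDerivAt (Ioo_mem_nhds ht.1 ht.2)).deriv

lemma ext_bdd {f : ℝ × ℝ → ℝ} (hf : ContDiffOn ℝ (⊤ : ℕ∞) f (Ici 0 ×ˢ Ioo 0 T)) (k : ℕ)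
    {t : ℝ} (ht : t ∈ Ioo 0 T) : ∃ C, 0 ≤ C ∧ ∀ r, 0 ≤ r → r ≤ 1 →
      |iteratedDeriv k (fun ρ => f (ρ, t)) r| ≤ C ∧
      |iteratedDeriv k (fun τ => f (r, τ)) t| ≤ C := by
  have key : ∀ v : ℝ × ℝ, ∃ C, ∀ r ∈ Icc (0:ℝ) 1,
      ‖((fun g : ℝ × ℝ → ℝ => fun p => fderivWithin ℝ g (Ici 0 ×ˢ Ioo 0 T) p v)^[k] f) (r, t)‖ ≤ C := by
    intro v
    apply isCompact_Icc.exists_bound_of_continuousOn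
    have hc := (ext_deriv hf v k).continuousOn
    exact hc.comp (f := fun r : ℝ => (r, t)) (by fun_prop) (fun r hr => ⟨hr.1, ht⟩)
  obtain ⟨C1, h1⟩ := key (1, 0)
  obtain ⟨C2, h2⟩ := key (0, 1)
  refine ⟨max (max C1 C2) (|iteratedDeriv k (fun ρ => f (ρ, t)) 0|),
    le_max_of_le_right (abs_nonneg _), fun r hr0 hr1 => ⟨?_, ?_⟩⟩
  · rcases hr0.eq_or_lt with e | e
    · rw [← e]; exact le_max_right _ _
    · rw [ext_r hf k r t e ht]
      exact (h1 r ⟨hr0, hr1⟩).trans ((le_max_left _ _).trans (le_max_left _ _))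
  · rw [ext_t hf k r t hr0 ht]
    exact (h2 r ⟨hr0, hr1⟩).trans ((le_max_right _ _).trans (le_max_left _ _))

end SDB

/-- Derivative bounds at any fixed time, for subcritical exponents `m ∈ (0, m_s]`. -/
theorem subcritical_derivative_bounds
    (N : ℕ) (hN : 3 ≤ N) (m T : ℝ)
    (hm : m ∈ Set.Ioc (0:ℝ) (((N : ℝ) - 2) / ((N : ℝ) + 2))) (hT : 0 < T)
    (u : ℝ → ℝ → ℝ) (hu : IsRadialEnergySolution N m T u) :
    ∀ t ∈ Set.Ioo (0:ℝ) T, ∀ k : ℕ, 1 ≤ k → ∃ C₁ > (0:ℝ), ∃ C₂ > (0:ℝ),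
      ∀ r ∈ Set.Ici (0:ℝ),
        |iteratedDeriv k (fun ρ => u ρ t) r| ≤ C₁ * Real.exp (-((N : ℝ) - 1) * r / m) ∧
        |iteratedDeriv k (fun τ => u r τ) t| ≤
          C₂ * Real.exp ((k : ℝ) * ((N : ℝ) - 1) * (1 / m - 1) * r) *
            Real.exp (-((N : ℝ) - 1) * r / m) := by
  intro t ht k hk
  obtain ⟨hm0, hms⟩ := hm
  have hN3 : (3:ℝ) ≤ N := by exact_mod_cast hN
  have hm1 : m < 1 := lt_of_le_of_lt hms (by rw [div_lt_one (by linarith)]; linarith)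
  have hbeta : 4 ≤ ((N:ℝ) - 2) * (1 / m - 1) := by
    rw [le_div_iff₀ (by linarith)] at hms
    have e : ((N:ℝ) - 2) * (1 / m - 1) = ((N:ℝ) - 2) * (1 - m) / m := by field_simp
    rw [e, le_div_iff₀ hm0]
    linarith
  have hb0 : 0 < 1 / m - 1 := by
    have : 1 < 1 / m := by rw [lt_div_iff₀ hm0]; linarith
    linarith
  obtain ⟨n, hnd⟩ : ∃ n, n = (N:ℝ) - 1 := ⟨_, rfl⟩
  have hn : 0 < n := by linarith
  have hγ0 : 4 < n * (1 / m - 1) := by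
    have : n * (1 / m - 1) = ((N:ℝ) - 2) * (1 / m - 1) + (1 / m - 1) := by rw [hnd]; ring
    linarith
  obtain ⟨h, hdef⟩ : ∃ h : ℝ × ℝ → ℝ, h = fun p => Real.log (u p.1 p.2) := ⟨_, rfl⟩
  have hh : SDB.Sm T h := by rw [hdef]; exact SDB.sol_sm hu
  have he : SDB.LogEq T m n h := by rw [hdef, hnd]; exact SDB.sol_log hu
  have hap : ∀ t1, 0 < t1 → t1 < T → ∃ V0, 1 ≤ V0 ∧ ∀ r t, 1 ≤ r → t1 ≤ t → t < T →
      Real.exp (m * h (r, t)) ≤ V0 * Real.exp (-(n / 2) * r) := by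
    intro t1 h1 h2
    rw [hdef, hnd]
    exact SDB.apriori hN hu h1 h2
  have hU : ∀ r t, (r, t) ∈ SDB.Om T → u r t = Real.exp (h (r, t)) := by
    intro r t hp
    rw [hdef]
    exact SDB.sol_exp hu hp
  have hP := SDB.plow_of hm0 hm1 hn.le hap
  have hB := SDB.bern hh he hP hm0 hm1 hn.le
  obtain ⟨Cu, hCu, hup⟩ := SDB.upper hh he hm0 hm1 hn (by linarith) hap ht.1 ht.2
  obtain ⟨Cl, hCl, hlow⟩ := SDB.lower hh he hm0 hm1 hn (by linarith) ht.1 ht.2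
  obtain ⟨f, hf, hfe⟩ := SDB.pol_r hh hU k
  obtain ⟨l, g, hg, hge⟩ := SDB.pol_t hh he hU k
  obtain ⟨F, hF0, hF⟩ := hf.bdd (hB k) t t ht.1 le_rfl ht.2
  obtain ⟨G, hG0, hG⟩ := hg.bdd (hB l) t t ht.1 le_rfl ht.2
  obtain ⟨C, hC0, hC⟩ := SDB.ext_bdd hu.smooth k ht
  have hx1 : ∀ r, 1 ≤ r → h (r, t) ≤ Real.log Cu / m + -n * r / m := by
    intro r hr
    have h1 := hup r hr
    rw [← Real.exp_log hCu, ← Real.exp_add, Real.exp_le_exp] at h1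
    rw [← add_div, le_div_iff₀ hm0]
    linarith
  have hx2 : ∀ r, 1 ≤ r → (m - 1) * h (r, t) ≤ -(1 / m - 1) * Real.log Cl + n * (1 / m - 1) * r := by
    intro r hr
    have h1 := hlow r hr
    rw [← Real.exp_log hCl, ← Real.exp_add, Real.exp_le_exp] at h1
    have h2 := mul_le_mul_of_nonneg_left h1 hb0.le
    have h3 : (1 / m - 1) * (m * h (r, t)) = (1 - m) * h (r, t) := by field_simp
    rw [h3] at h2
    linarith
  obtain ⟨a, ha⟩ : ∃ a, a = Real.log Cu / m := ⟨_, rfl⟩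
  obtain ⟨b, hb⟩ : ∃ b, b = -(1 / m - 1) * Real.log Cl := ⟨_, rfl⟩
  rw [← ha] at hx1
  rw [← hb] at hx2
  have hlb : ∀ r, 0 ≤ r → r ≤ 1 → C ≤ C * Real.exp (n / m) * Real.exp (-n * r / m) := by
    intro r h0 h1
    rw [mul_assoc, ← Real.exp_add]
    apply le_mul_of_one_le_right hC0
    apply Real.one_le_exp
    rw [← add_div]
    apply div_nonneg _ hm0.le
    have := mul_le_mul_of_nonneg_left h1 hn.le
    linarith
  rw [← hnd]
  refine ⟨C * Real.exp (n / m) + Real.exp a * F + 1, by positivity,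
    C * Real.exp (n / m) + Real.exp (a + k * b) * G + 1, by positivity, fun r hr => ?_⟩
  have hr0 : 0 ≤ r := hr
  have E1 := Real.exp_pos (-n * r / m)
  have E2 := Real.exp_pos ((k:ℝ) * n * (1 / m - 1) * r)
  rcases le_total r 1 with hr1 | hr1
  · have hk0 : (0:ℝ) ≤ (k:ℝ) * n * (1 / m - 1) * r := by positivity
    have hk1 := Real.one_le_exp hk0
    obtain ⟨c1, c2⟩ := hC r hr0 hr1
    have c3 := hlb r hr0 hr1
    constructor
    · have : 0 ≤ (Real.exp a * F + 1) * Real.exp (-n * r / m) := by positivity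
      linarith
    · have c4 : C * Real.exp (n / m) * Real.exp (-n * r / m) ≤
          (C * Real.exp (n / m) * Real.exp (-n * r / m)) *
            Real.exp ((k:ℝ) * n * (1 / m - 1) * r) := le_mul_of_one_le_right (by positivity) hk1
      have : 0 ≤ (Real.exp (a + k * b) * G + 1) * Real.exp ((k:ℝ) * n * (1 / m - 1) * r) *
        Real.exp (-n * r / m) := by positivity
      linarith
  · have hp : (r, t) ∈ SDB.Om T := SDB.mem_Om.2 ⟨by linarith, ht.1, ht.2⟩
    rw [hfe r t hp, hge r t hp, abs_mul, abs_mul, Real.abs_exp, Real.abs_exp]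
    have x1 := hx1 r hr1
    have x2 := hx2 r hr1
    have f1 := hF r t hr1 le_rfl le_rfl
    have g1 := hG r t hr1 le_rfl le_rfl
    constructor
    · have e1 : Real.exp (h (r, t)) ≤ Real.exp a * Real.exp (-n * r / m) := by
        rw [← Real.exp_add, Real.exp_le_exp]; exact x1
      have e2 := mul_le_mul e1 f1 (abs_nonneg _) (by positivity)
      have : 0 ≤ (C * Real.exp (n / m) + 1) * Real.exp (-n * r / m) := by positivity
      linarith
    · have e1 : Real.exp (h (r, t) + k * ((m - 1) * h (r, t))) ≤ Real.exp (a + k * b) *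
          (Real.exp ((k:ℝ) * n * (1 / m - 1) * r) * Real.exp (-n * r / m)) := by
        rw [← Real.exp_add, ← Real.exp_add, Real.exp_le_exp]
        have := mul_le_mul_of_nonneg_left x2 (Nat.cast_nonneg (α := ℝ) k)
        linarith
      have e2 := mul_le_mul e1 g1 (abs_nonneg _) (by positivity)
      have : 0 ≤ (C * Real.exp (n / m) + 1) * Real.exp ((k:ℝ) * n * (1 / m - 1) * r) *
        Real.exp (-n * r / m) := by positivity
      linarith
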